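/- arXiv:2006.16602 — 2 statements merged into one kernel-verified Lean document; each statement's English description precedes it below -/
import Mathlib

section
/- Let M be a metric space, f : M → M a homeomorphism, and H ⊆ M a σ₂-horseshoe for f, i.e. there is a homeomorphism k : Σ₂ → H (onto H) with f ∘ k = k ∘ σ. Then for every irrational real number α with 0 < α < 1/2 there exists a weak Denjoy sub-system (K_α, j_α, h_α) for f whose rotation number ρ(h_α) is the class of α in 𝕋 and such that j_α(K_α) ⊆ H. -/
open Filter Topology Set

noncomputable section

/-- A Denjoy example: an orientation-preserving circle homeomorphism with
irrational rotation number together with its minimal invariant Cantor set. -/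
structure DenjoySystem where
  /-- the circle homeomorphism -/
  h : UnitAddCircle ≃ₜ UnitAddCircle
  /-- the minimal set -/
  K : Set UnitAddCircle
  /-- a lift of `h` to `ℝ` -/
  lift : ℝ → ℝ
  lift_mono : StrictMono lift
  lift_cont : Continuous lift
  lift_bij : Function.Bijective lift
  lift_add : ∀ x : ℝ, lift (x + 1) = lift x + 1
  lift_proj : ∀ x : ℝ, ((lift x : ℝ) : UnitAddCircle) = h (x : UnitAddCircle)
  /-- a representative of the rotation number -/
  rot : ℝ
  rot_lim : Filter.Tendsto (fun n : ℕ => lift^[n] 0 / (n : ℝ)) Filter.atTop (nhds rot)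
  rot_irr : Irrational rot
  K_ne : K.Nonempty
  K_cpt : IsCompact K
  K_proper : K ≠ Set.univ
  K_inv : h '' K = K
  K_perf : Perfect K
  K_td : IsTotallyDisconnected K
  K_min : ∀ x ∈ K, ∀ y ∈ K, y ∈ closure {z | ∃ n : ℤ, (h.toEquiv ^ n) x = z}

/-- A weak Denjoy sub-system (WDS) for a map `f : M → M`. -/
structure WDS (M : Type*) [TopologicalSpace M] (f : M → M) extends DenjoySystem where
  /-- the embedding of the minimal set into `M` -/
  j : K → M
  j_emb : Topology.IsEmbedding j
  range_inv : f '' Set.range j = Set.range j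
  equivar : ∀ x y : K, h (x : UnitAddCircle) = (y : UnitAddCircle) → j y = f (j x)

/-- Weak cyclic order on the circle. -/
def CircBtw (a b c : UnitAddCircle) : Prop :=
  ∃ x y z : ℝ, (x : UnitAddCircle) = a ∧ (y : UnitAddCircle) = b ∧ (z : UnitAddCircle) = c ∧
    x ≤ y ∧ y ≤ z ∧ z ≤ x + 1

/-- The order graph of a WDS. -/
def WDS.orderGraph {M : Type*} [TopologicalSpace M] {f : M → M} (W : WDS M f) :
    Set (M × M × M) :=
  {p | ∃ a b c : W.K, CircBtw (a : UnitAddCircle) (b : UnitAddCircle) (c : UnitAddCircle) ∧ p = (W.j a, W.j b, W.j c)}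

/-- The reverse of the order graph of a WDS. -/
def WDS.revGraph {M : Type*} [TopologicalSpace M] {f : M → M} (W : WDS M f) :
    Set (M × M × M) :=
  {p | (p.2.2, p.2.1, p.1) ∈ W.orderGraph}


/-- The shift on the space `Σ₂ = {0,1}^ℤ` of two-sided binary sequences. -/
def shift2 (u : ℤ → Fin 2) : ℤ → Fin 2 := fun k => u (k + 1)

/-- Abstract data for blowing up one orbit of the rotation by `α`. -/
structure DJ (α : ℝ) where
  P : ℝ → ℝ
  N : ℝ → ℝ
  P_add : ∀ x, P (x + 1) = P x + 1
  N_add : ∀ x, N (x + 1) = N x + 1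
  le : ∀ x, N x ≤ P x
  lt : ∀ x y, x < y → P x < N y
  shift : ∀ x, N x < P x ↔ N (x + α) < P (x + α)
  gap0 : N 0 < P 0
  gap_orbit : ∀ x, N x < P x → ∃ n m : ℤ, x = n * α + m
  Pc : ∀ x ε, 0 < ε → ∃ δ > 0, P (x + δ) < P x + ε
  Nc : ∀ x ε, 0 < ε → ∃ δ > 0, N x - ε < N (x - δ)
  P0 : P 0 = 0
  bd : ∀ x, |P x - x| ≤ 1

theorem dj_dense {α : ℝ} (hα : Irrational α) {a b : ℝ} (hab : a < b) :
    ∃ n m : ℤ, a < n * α + m ∧ n * α + m < b := by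
  have h : Dense (AddSubgroup.closure {α, (1 : ℝ)} : Set ℝ) := by
    rw [dense_addSubgroupClosure_pair_iff]; simpa using hα
  obtain ⟨c, hc, h1, h2⟩ := h.exists_between hab
  obtain ⟨n, m, rfl⟩ := AddSubgroup.mem_closure_pair.1 hc
  simp only [zsmul_eq_mul, mul_one] at h1 h2
  exact ⟨n, m, h1, h2⟩

theorem dj_weights : ∃ w : ℤ → ℝ, (∀ n, 0 < w n) ∧ HasSum w 1 := by
  obtain ⟨u, hu, c, hc, -⟩ := posSumOfEncodable (ε := 1) one_pos ℤ
  have hpos : 0 < c := by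
    rw [← hc.tsum_eq]; exact hc.summable.tsum_pos (fun n => (hu n).le) 0 (hu 0)
  refine ⟨fun n => u n / c, fun n => div_pos (hu n) hpos, ?_⟩
  have := hc.div_const c
  rwa [div_self hpos.ne'] at this

theorem floor_right (a : ℝ) : ∃ δ > 0, ∀ y, a ≤ y → y < a + δ → ⌊y⌋ = ⌊a⌋ := by
  refine ⟨⌊a⌋ + 1 - a, by linarith [Int.lt_floor_add_one a], fun y h1 h2 => ?_⟩
  rw [Int.floor_eq_iff]
  constructor
  · linarith [Int.floor_le a]
  · linarith

theorem ceil_left (a : ℝ) : ∃ δ > 0, ∀ y, y ≤ a → a - δ < y → ⌈y⌉ = ⌈a⌉ := by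
  refine ⟨a - (⌈a⌉ - 1), by linarith [Int.ceil_lt_add_one a], fun y h1 h2 => ?_⟩
  rw [Int.ceil_eq_iff]
  constructor
  · linarith
  · linarith [Int.le_ceil a]

theorem dj_exists {α : ℝ} (hα : Irrational α) : Nonempty (DJ α) := by
  obtain ⟨w, hw, hs⟩ := dj_weights
  let p : ℝ → ℤ → ℝ := fun x n => w n * ((⌊x - n * α⌋ : ℝ) - ⌊-(n * α)⌋)
  let q : ℝ → ℤ → ℝ := fun x n => w n * ((⌈x - n * α⌉ : ℝ) - 1 - ⌊-(n * α)⌋)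
  have pb : ∀ x n, w n * (x - 1) ≤ p x n ∧ p x n ≤ w n * (x + 1) := by
    intro x n
    have h1 := Int.floor_le (x - n * α)
    have h2 := Int.lt_floor_add_one (x - n * α)
    have h3 := Int.floor_le (-(n * α))
    have h4 := Int.lt_floor_add_one (-(n * α))
    exact ⟨mul_le_mul_of_nonneg_left (by linarith) (hw n).le,
      mul_le_mul_of_nonneg_left (by linarith) (hw n).le⟩
  have qb : ∀ x n, w n * (x - 1) ≤ q x n ∧ q x n ≤ w n * (x + 1) := by
    intro x n
    have h1 := Int.le_ceil (x - n * α)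
    have h2 := Int.ceil_lt_add_one (x - n * α)
    have h3 := Int.floor_le (-(n * α))
    have h4 := Int.lt_floor_add_one (-(n * α))
    exact ⟨mul_le_mul_of_nonneg_left (by linarith) (hw n).le,
      mul_le_mul_of_nonneg_left (by linarith) (hw n).le⟩
  have ab : ∀ (r x w c : ℝ), 0 < w → |x| ≤ c → w * (x - 1) ≤ r ∧ r ≤ w * (x + 1) →
      ‖r‖ ≤ w * (c + 1) := by
    intro r x w c hw hc h
    rw [Real.norm_eq_abs, abs_le]
    have := abs_le.1 hc
    constructor
    · refine le_trans ?_ h.1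
      rw [← mul_neg]; exact mul_le_mul_of_nonneg_left (by linarith) hw.le
    · exact h.2.trans (mul_le_mul_of_nonneg_left (by linarith) hw.le)
  have ps : ∀ x, Summable (p x) := fun x =>
    Summable.of_norm_bounded (hs.summable.mul_right (|x| + 1))
      (fun n => ab _ x _ _ (hw n) le_rfl (pb x n))
  have qs : ∀ x, Summable (q x) := fun x =>
    Summable.of_norm_bounded (hs.summable.mul_right (|x| + 1))
      (fun n => ab _ x _ _ (hw n) le_rfl (qb x n))
  have hqp : ∀ x, q x ≤ p x := by
    intro x n
    refine mul_le_mul_of_nonneg_left ?_ (hw n).le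
    have : (⌈x - n * α⌉ : ℝ) ≤ ⌊x - n * α⌋ + 1 := by exact_mod_cast Int.ceil_le_floor_add_one _
    linarith
  have gap : ∀ x, (∑' n, q x n < ∑' n, p x n) ↔ ∃ n m : ℤ, x = n * α + m := by
    intro x
    constructor
    · intro h
      by_contra! hne
      have : q x = p x := by
        funext n
        have h3 : (⌈x - n * α⌉ : ℝ) = ⌊x - n * α⌋ + 1 := by
          have : ⌈x - n * α⌉ = ⌊x - n * α⌋ + 1 := by
            rw [Int.ceil_eq_iff]
            push_cast
            refine ⟨?_, (Int.lt_floor_add_one _).le⟩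
            rcases (Int.floor_le (x - n * α)).lt_or_eq with h | h
            · linarith
            · exact absurd (by linarith) (hne n ⌊x - n * α⌋)
          exact_mod_cast this
        simp only [p, q, h3]; ring
      rw [this] at h; exact lt_irrefl _ h
    · rintro ⟨n, m, rfl⟩
      refine Summable.tsum_lt_tsum (hqp _) (i := n) ?_ (qs _) (ps _)
      refine mul_lt_mul_of_pos_left ?_ (hw n)
      simp
  refine ⟨⟨fun x => ∑' n, p x n, fun x => ∑' n, q x n, ?_, ?_, ?_, ?_, ?_, ?_, ?_, ?_, ?_, ?_, ?_⟩⟩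
  · intro x
    have : p (x + 1) = fun n => p x n + w n := by
      funext n
      have : x + 1 - n * α = x - n * α + 1 := by ring
      simp only [p, this, Int.floor_add_one]; push_cast; ring
    rw [this, (ps x).tsum_add hs.summable, hs.tsum_eq]
  · intro x
    have : q (x + 1) = fun n => q x n + w n := by
      funext n
      have : x + 1 - n * α = x - n * α + 1 := by ring
      simp only [q, this, Int.ceil_add_one]; push_cast; ring
    rw [this, (qs x).tsum_add hs.summable, hs.tsum_eq]
  · intro x
    exact (qs x).tsum_le_tsum (hqp x) (ps x)
  · intro x y hxy
    obtain ⟨n, m, h1, h2⟩ := dj_dense hα hxy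
    refine Summable.tsum_lt_tsum ?_ (i := n) ?_ (ps _) (qs _)
    · intro k
      refine mul_le_mul_of_nonneg_left ?_ (hw k).le
      have : ⌊x - k * α⌋ + 1 ≤ ⌈y - k * α⌉ := by
        rw [Int.add_one_le_iff, Int.lt_ceil]
        linarith [Int.floor_le (x - k * α)]
      have : (⌊x - k * α⌋ : ℝ) + 1 ≤ ⌈y - k * α⌉ := by exact_mod_cast this
      linarith
    · refine mul_lt_mul_of_pos_left ?_ (hw n)
      have h3 : ⌊x - n * α⌋ + 1 ≤ m := by
        rw [Int.add_one_le_iff, Int.floor_lt]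
        linarith
      have h4 : m + 1 ≤ ⌈y - n * α⌉ := by
        rw [Int.add_one_le_iff, Int.lt_ceil]
        linarith
      have h5 : (⌊x - n * α⌋ : ℝ) + 1 + 1 ≤ ⌈y - n * α⌉ := by exact_mod_cast (by omega)
      linarith
  · intro x
    rw [gap, gap]
    constructor
    · rintro ⟨n, m, h⟩
      exact ⟨n + 1, m, by rw [h]; push_cast; ring⟩
    · rintro ⟨n, m, h⟩
      exact ⟨n - 1, m, by push_cast; linarith⟩
  · rw [gap]; exact ⟨0, 0, by simp⟩
  · intro x; exact (gap x).1
  · intro x ε hε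
    have ht : Tendsto (fun δ : ℝ => ∑' n, p (x + δ) n) (𝓝[>] 0) (𝓝 (∑' n, p x n)) := by
      refine tendsto_tsum_of_dominated_convergence (bound := fun n => w n * (|x| + 1 + 1))
        (hs.summable.mul_right _) ?_ ?_
      · intro n
        obtain ⟨δ, hδ, h⟩ := floor_right (x - n * α)
        refine tendsto_const_nhds.congr' ?_
        filter_upwards [Ioo_mem_nhdsGT hδ] with d hd
        have := h (x + d - n * α) (by linarith [hd.1]) (by linarith [hd.2])
        simp only [p, this]
      · filter_upwards [Ioo_mem_nhdsGT one_pos] with d hd n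
        refine ab _ (x + d) _ _ (hw n) ?_ (pb _ _)
        refine (abs_add_le _ _).trans ?_
        rw [abs_of_pos hd.1]; linarith [hd.2]
    obtain ⟨d, h1, h2⟩ := ((ht.eventually (gt_mem_nhds (lt_add_of_pos_right _ hε))).and
      self_mem_nhdsWithin).exists
    exact ⟨d, h2, h1⟩
  · intro x ε hε
    have ht : Tendsto (fun δ : ℝ => ∑' n, q (x - δ) n) (𝓝[>] 0) (𝓝 (∑' n, q x n)) := by
      refine tendsto_tsum_of_dominated_convergence (bound := fun n => w n * (|x| + 1 + 1))
        (hs.summable.mul_right _) ?_ ?_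
      · intro n
        obtain ⟨δ, hδ, h⟩ := ceil_left (x - n * α)
        refine tendsto_const_nhds.congr' ?_
        filter_upwards [Ioo_mem_nhdsGT hδ] with d hd
        have := h (x - d - n * α) (by linarith [hd.1]) (by linarith [hd.2])
        simp only [q, this]
      · filter_upwards [Ioo_mem_nhdsGT one_pos] with d hd n
        refine ab _ (x - d) _ _ (hw n) ?_ (qb _ _)
        refine (abs_sub _ _).trans ?_
        rw [abs_of_pos hd.1]; linarith [hd.2]
    obtain ⟨d, h1, h2⟩ := ((ht.eventually (lt_mem_nhds (sub_lt_self _ hε))).and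
      self_mem_nhdsWithin).exists
    exact ⟨d, h2, h1⟩
  · have : p 0 = 0 := by funext n; simp [p]
    rw [this]; simp
  · intro x
    have h1 := (hs.summable.mul_right (x - 1)).tsum_le_tsum (fun n => (pb x n).1) (ps x)
    have h2 := (ps x).tsum_le_tsum (fun n => (pb x n).2) (hs.summable.mul_right (x + 1))
    rw [tsum_mul_right, hs.tsum_eq] at h1 h2
    rw [abs_le]; constructor <;> linarith

namespace DJ

theorem P_mono {α : ℝ} (D : DJ α) {x y : ℝ} (h : x < y) : D.P x < D.P y :=
  (D.lt x y h).trans_le (D.le y)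

theorem N_mono {α : ℝ} (D : DJ α) {x y : ℝ} (h : x < y) : D.N x < D.N y :=
  (D.le x).trans_lt (D.lt x y h)

theorem exists_pi {α : ℝ} (D : DJ α) (y : ℝ) : ∃ x, D.N x ≤ y ∧ y ≤ D.P x := by
  let S : Set ℝ := {x | D.N x ≤ y}
  have hne : S.Nonempty := by
    refine ⟨y - 1, ?_⟩
    have h1 := D.le (y - 1)
    have h2 := (abs_le.1 (D.bd (y - 1))).2
    show D.N (y - 1) ≤ y
    linarith
  have hbd : BddAbove S := by
    refine ⟨y + 2, fun x hx => ?_⟩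
    have h1 := D.lt (x - 1) x (by linarith)
    have h2 := (abs_le.1 (D.bd (x - 1))).1
    have h3 : D.N x ≤ y := hx
    linarith
  refine ⟨sSup S, ?_, ?_⟩
  · by_contra! h
    obtain ⟨δ, hδ, h1⟩ := D.Nc (sSup S) (D.N (sSup S) - y) (by linarith)
    obtain ⟨x, hx, hx2⟩ := exists_lt_of_lt_csSup hne (show sSup S - δ < sSup S by linarith)
    have h3 : D.N x ≤ y := hx
    have := D.N_mono hx2
    linarith
  · by_contra! h
    obtain ⟨δ, hδ, h1⟩ := D.Pc (sSup S) (y - D.P (sSup S)) (by linarith)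
    have h2 := D.le (sSup S + δ)
    have : sSup S + δ ≤ sSup S := le_csSup hbd (show D.N (sSup S + δ) ≤ y by linarith)
    linarith

/-- The semiconjugacy to the translation. -/
def pi {α : ℝ} (D : DJ α) (y : ℝ) : ℝ := (D.exists_pi y).choose

theorem N_pi {α : ℝ} (D : DJ α) (y : ℝ) : D.N (D.pi y) ≤ y := (D.exists_pi y).choose_spec.1

theorem P_pi {α : ℝ} (D : DJ α) (y : ℝ) : y ≤ D.P (D.pi y) := (D.exists_pi y).choose_spec.2

theorem pi_eq {α : ℝ} (D : DJ α) {x y : ℝ} (h1 : D.N x ≤ y) (h2 : y ≤ D.P x) : D.pi y = x := by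
  have h3 := D.N_pi y
  have h4 := D.P_pi y
  rcases lt_trichotomy (D.pi y) x with h | h | h
  · linarith [D.lt _ _ h]
  · exact h
  · linarith [D.lt _ _ h]

theorem pi_P {α : ℝ} (D : DJ α) (x : ℝ) : D.pi (D.P x) = x := D.pi_eq (D.le x) le_rfl

theorem pi_N {α : ℝ} (D : DJ α) (x : ℝ) : D.pi (D.N x) = x := D.pi_eq le_rfl (D.le x)

theorem pi_mono {α : ℝ} (D : DJ α) {y z : ℝ} (h : y ≤ z) : D.pi y ≤ D.pi z := by
  by_contra! h1
  linarith [D.lt _ _ h1, D.N_pi y, D.P_pi z]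

theorem pi_add {α : ℝ} (D : DJ α) (y : ℝ) : D.pi (y + 1) = D.pi y + 1 := by
  apply D.pi_eq
  · rw [D.N_add]; linarith [D.N_pi y]
  · rw [D.P_add]; linarith [D.P_pi y]

/-- The blown-up translation. -/
def T {α : ℝ} (D : DJ α) (s y : ℝ) : ℝ :=
  D.N (D.pi y + s) + (y - D.N (D.pi y)) / (D.P (D.pi y) - D.N (D.pi y)) *
    (D.P (D.pi y + s) - D.N (D.pi y + s))

/-- Translations respecting the gaps. -/
def Good {α : ℝ} (D : DJ α) (s : ℝ) : Prop := ∀ x, D.N x < D.P x ↔ D.N (x + s) < D.P (x + s)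

theorem good_pos {α : ℝ} (D : DJ α) : D.Good α := D.shift

theorem good_neg {α : ℝ} (D : DJ α) : D.Good (-α) := by
  intro x
  rw [D.shift (x + -α)]; simp

theorem frac_mem {α : ℝ} (D : DJ α) (y : ℝ) :
    0 ≤ (y - D.N (D.pi y)) / (D.P (D.pi y) - D.N (D.pi y)) ∧
    (y - D.N (D.pi y)) / (D.P (D.pi y) - D.N (D.pi y)) ≤ 1 := by
  have h1 := D.N_pi y
  have h2 := D.P_pi y
  exact ⟨div_nonneg (by linarith) (by linarith), div_le_one_of_le₀ (by linarith) (by linarith)⟩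

theorem N_T {α : ℝ} (D : DJ α) (s y : ℝ) : D.N (D.pi y + s) ≤ D.T s y := by
  have := mul_nonneg (D.frac_mem y).1 (sub_nonneg.2 (D.le (D.pi y + s)))
  unfold T; linarith

theorem T_P' {α : ℝ} (D : DJ α) (s y : ℝ) : D.T s y ≤ D.P (D.pi y + s) := by
  have := mul_le_mul_of_nonneg_right (D.frac_mem y).2 (sub_nonneg.2 (D.le (D.pi y + s)))
  unfold T; linarith

theorem pi_T {α : ℝ} (D : DJ α) (s y : ℝ) : D.pi (D.T s y) = D.pi y + s :=
  D.pi_eq (D.N_T s y) (D.T_P' s y)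

theorem T_strictMono {α : ℝ} (D : DJ α) {s : ℝ} (hs : D.Good s) : StrictMono (D.T s) := by
  intro y z h
  rcases (D.pi_mono h.le).lt_or_eq with h1 | h1
  · have := D.lt (D.pi y + s) (D.pi z + s) (by linarith)
    linarith [D.T_P' s y, D.N_T s z]
  · have h2 : D.N (D.pi y) < D.P (D.pi y) := by
      linarith [D.N_pi y, D.P_pi z, congrArg D.P h1]
    have h3 := (hs _).1 h2
    unfold T
    rw [← h1]
    have := div_lt_div_of_pos_right (show y - D.N (D.pi y) < z - D.N (D.pi y) by linarith)
      (sub_pos.2 h2)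
    have := mul_lt_mul_of_pos_right this (sub_pos.2 h3)
    linarith

theorem T_inv {α : ℝ} (D : DJ α) {s : ℝ} (hs : D.Good s) (y : ℝ) : D.T (-s) (D.T s y) = y := by
  have e : D.pi y + s + -s = D.pi y := by ring
  rcases (D.le (D.pi y)).lt_or_eq with h | h
  · have h3 := (hs _).1 h
    rw [T, D.pi_T, e, T]
    have := sub_pos.2 h
    have := sub_pos.2 h3
    field_simp
    ring
  · have h1 : D.T (-s) (D.T s y) = D.N (D.pi y) := by
      rw [T, D.pi_T, e, h]; simp
    rw [h1]
    linarith [D.N_pi y, D.P_pi y]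

theorem T_N {α : ℝ} (D : DJ α) (s x : ℝ) : D.T s (D.N x) = D.N (x + s) := by
  rw [T, D.pi_N]; simp

theorem T_P {α : ℝ} (D : DJ α) {s : ℝ} (hs : D.Good s) (x : ℝ) : D.T s (D.P x) = D.P (x + s) := by
  rw [T, D.pi_P]
  rcases (D.le x).lt_or_eq with h | h
  · rw [div_self (sub_pos.2 h).ne']; ring
  · have : ¬ D.N (x + s) < D.P (x + s) := by rw [← hs x, h]; exact lt_irrefl _
    have : D.N (x + s) = D.P (x + s) := le_antisymm (D.le _) (not_lt.1 this)
    rw [this]; simp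

theorem T_add {α : ℝ} (D : DJ α) (s y : ℝ) : D.T s (y + 1) = D.T s y + 1 := by
  have e : D.pi y + 1 + s = D.pi y + s + 1 := by ring
  rw [T, T, D.pi_add, e, D.N_add, D.P_add, D.N_add, D.P_add]
  simp only [add_sub_add_right_eq_sub]
  ring

/-- The lift of the Denjoy homeomorphism. -/
def H {α : ℝ} (D : DJ α) : ℝ ≃o ℝ :=
  StrictMono.orderIsoOfRightInverse (D.T α) (D.T_strictMono D.good_pos) (D.T (-α))
    (fun y => by simpa using D.T_inv D.good_neg y)

theorem H_apply {α : ℝ} (D : DJ α) (y : ℝ) : D.H y = D.T α y := rfl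

theorem H_symm_apply {α : ℝ} (D : DJ α) (y : ℝ) : D.H.symm y = D.T (-α) y := rfl

theorem Hz_add {α : ℝ} (D : DJ α) (n : ℤ) (y : ℝ) : (D.H ^ n) (y + 1) = (D.H ^ n) y + 1 := by
  induction n generalizing y with
  | zero => simp
  | succ n ih => rw [zpow_add_one, RelIso.mul_apply, RelIso.mul_apply, H_apply, T_add, ih]; rfl
  | pred n ih =>
    rw [zpow_sub_one, RelIso.mul_apply, RelIso.mul_apply]
    show (D.H ^ _) (D.H.symm _) = (D.H ^ _) (D.H.symm _) + 1
    rw [H_symm_apply, T_add, ih]; rfl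

theorem Hz_P {α : ℝ} (D : DJ α) (n : ℤ) (x : ℝ) : (D.H ^ n) (D.P x) = D.P (x + n * α) := by
  induction n generalizing x with
  | zero => simp
  | succ n ih =>
    rw [zpow_add_one, RelIso.mul_apply, H_apply, T_P _ D.good_pos, ih]; push_cast; ring_nf
  | pred n ih =>
    rw [zpow_sub_one, RelIso.mul_apply]
    show (D.H ^ _) (D.H.symm _) = _
    rw [H_symm_apply, T_P _ D.good_neg, ih]; push_cast; ring_nf

theorem Hz_N {α : ℝ} (D : DJ α) (n : ℤ) (x : ℝ) : (D.H ^ n) (D.N x) = D.N (x + n * α) := by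
  induction n generalizing x with
  | zero => simp
  | succ n ih =>
    rw [zpow_add_one, RelIso.mul_apply, H_apply, T_N, ih]; push_cast; ring_nf
  | pred n ih =>
    rw [zpow_sub_one, RelIso.mul_apply]
    show (D.H ^ _) (D.H.symm _) = _
    rw [H_symm_apply, T_N, ih]; push_cast; ring_nf

theorem add_int_of {g : ℝ → ℝ} (h : ∀ x, g (x + 1) = g x + 1) (m : ℤ) (x : ℝ) :
    g (x + m) = g x + m := by
  induction m with
  | zero => simp
  | succ n ih => push_cast at *; rw [← add_assoc, h, ih]; ring
  | pred n ih =>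
    have := h (x + ((-(n : ℤ) - 1 : ℤ) : ℝ))
    push_cast at *
    rw [show x + (-(n : ℝ) - 1) + 1 = x + -n by ring, ih] at this
    linarith

theorem Hz_add_int {α : ℝ} (D : DJ α) (n m : ℤ) (y : ℝ) : (D.H ^ n) (y + m) = (D.H ^ n) y + m :=
  add_int_of (D.Hz_add n) m y

theorem gap {α : ℝ} (D : DJ α) (n m : ℤ) : D.N (n * α + m) < D.P (n * α + m) := by
  rw [add_int_of D.N_add, add_int_of D.P_add]
  have h1 := D.Hz_N n 0
  have h2 := D.Hz_P n 0
  have := (D.H ^ n).strictMono D.gap0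
  rw [h1, h2, zero_add] at this
  linarith

theorem coe_eq {a b : ℝ} : (a : UnitAddCircle) = b ↔ ∃ m : ℤ, b = a + m := by
  rw [QuotientAddGroup.eq, AddSubgroup.mem_zmultiples_iff]
  constructor
  · rintro ⟨m, hm⟩
    exact ⟨m, by simp at hm; linarith⟩
  · rintro ⟨m, hm⟩
    exact ⟨m, by simp [hm]⟩

theorem coe_per {g : ℝ → ℝ} (h : ∀ x, g (x + 1) = g x + 1) :
    Function.Periodic (fun x => (g x : UnitAddCircle)) 1 := by
  intro x
  simp only
  rw [h]; exact AddCircle.coe_add_period 1 _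

/-- The circle homeomorphism. -/
def h {α : ℝ} (D : DJ α) : UnitAddCircle ≃ₜ UnitAddCircle where
  toFun := (coe_per (D.T_add α)).lift
  invFun := (coe_per (D.T_add (-α))).lift
  left_inv := by
    intro x
    induction x using QuotientAddGroup.induction_on with | _ y => ?_
    rw [Function.Periodic.lift_coe, Function.Periodic.lift_coe, D.T_inv D.good_pos]
  right_inv := by
    intro x
    induction x using QuotientAddGroup.induction_on with | _ y => ?_
    rw [Function.Periodic.lift_coe, Function.Periodic.lift_coe]
    have := D.T_inv D.good_neg y
    rw [neg_neg] at this
    rw [this]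
  continuous_toFun := by
    refine QuotientAddGroup.isOpenQuotientMap_mk.isQuotientMap.continuous_iff.2 ?_
    exact (AddCircle.continuous_mk' 1).comp D.H.continuous
  continuous_invFun := by
    refine QuotientAddGroup.isOpenQuotientMap_mk.isQuotientMap.continuous_iff.2 ?_
    exact (AddCircle.continuous_mk' 1).comp D.H.symm.continuous

theorem h_coe {α : ℝ} (D : DJ α) (y : ℝ) : D.h (y : UnitAddCircle) = (D.H y : ℝ) := rfl

theorem h_symm_coe {α : ℝ} (D : DJ α) (y : ℝ) : D.h.symm (y : UnitAddCircle) = (D.H.symm y : ℝ) :=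
  rfl

theorem hz_coe {α : ℝ} (D : DJ α) (n : ℤ) (y : ℝ) :
    (D.h.toEquiv ^ n) (y : UnitAddCircle) = ((D.H ^ n) y : ℝ) := by
  induction n generalizing y with
  | zero => simp
  | succ n ih => rw [zpow_add_one, zpow_add_one, RelIso.mul_apply, Equiv.Perm.mul_apply, ← ih]; rfl
  | pred n ih =>
    rw [zpow_sub_one, zpow_sub_one, RelIso.mul_apply, Equiv.Perm.mul_apply]
    exact ih (D.H.symm y)

/-- The lifted minimal set. -/
def Kt {α : ℝ} (D : DJ α) : Set ℝ := {y | ∃ x, y = D.N x ∨ y = D.P x}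

/-- The minimal set. -/
def K {α : ℝ} (D : DJ α) : Set UnitAddCircle := (fun y : ℝ => (y : UnitAddCircle)) '' D.Kt

theorem mem_K {α : ℝ} (D : DJ α) (y : ℝ) : (y : UnitAddCircle) ∈ D.K ↔ y ∈ D.Kt := by
  refine ⟨?_, fun h => ⟨y, h, rfl⟩⟩
  rintro ⟨z, ⟨x, hx⟩, hz⟩
  obtain ⟨m, rfl⟩ := coe_eq.1 hz
  refine ⟨x + m, ?_⟩
  rw [add_int_of D.N_add, add_int_of D.P_add]
  simpa using hx

theorem Hz_Kt {α : ℝ} (D : DJ α) (n : ℤ) {y : ℝ} (h : y ∈ D.Kt) : (D.H ^ n) y ∈ D.Kt := by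
  obtain ⟨x, rfl | rfl⟩ := h
  · exact ⟨_, Or.inl (D.Hz_N n x)⟩
  · exact ⟨_, Or.inr (D.Hz_P n x)⟩

theorem not_Kt {α : ℝ} (D : DJ α) {x y : ℝ} (h1 : D.N x < y) (h2 : y < D.P x) : y ∉ D.Kt := by
  rintro ⟨z, rfl | rfl⟩
  · have := D.pi_eq h1.le h2.le
    rw [D.pi_N] at this
    subst this; exact lt_irrefl _ h1
  · have := D.pi_eq h1.le h2.le
    rw [D.pi_P] at this
    subst this; exact lt_irrefl _ h2

theorem Kt_closed {α : ℝ} (D : DJ α) : IsClosed D.Kt := by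
  rw [← isOpen_compl_iff, isOpen_iff_mem_nhds]
  intro y hy
  have h1 : D.N (D.pi y) < y :=
    lt_of_le_of_ne (D.N_pi y) (fun h => hy ⟨_, Or.inl h.symm⟩)
  have h2 : y < D.P (D.pi y) :=
    lt_of_le_of_ne (D.P_pi y) (fun h => hy ⟨_, Or.inr h⟩)
  filter_upwards [Ioo_mem_nhds h1 h2] with z hz
  exact D.not_Kt hz.1 hz.2

theorem K_closed {α : ℝ} (D : DJ α) : IsClosed D.K := by
  rw [← QuotientAddGroup.isOpenQuotientMap_mk.isQuotientMap.isClosed_preimage]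
  convert D.Kt_closed using 1
  ext y
  exact D.mem_K y

/-- Near each point of the lifted minimal set there is a full interval of blown-up points. -/
theorem approx {α : ℝ} (D : DJ α) {y : ℝ} (hy : y ∈ D.Kt) {ε : ℝ} (hε : 0 < ε) :
    ∃ a b : ℝ, a < b ∧ ∀ x, a < x → x < b →
      |D.N x - y| < ε ∧ |D.P x - y| < ε ∧ D.N x ≠ y ∧ D.P x ≠ y := by
  obtain ⟨z, rfl | rfl⟩ := hy
  · obtain ⟨δ, hδ, h⟩ := D.Nc z ε hε
    refine ⟨z - δ, z, by linarith, fun x h1 h2 => ?_⟩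
    have h3 := D.N_mono h1
    have h4 := D.lt _ _ h2
    have h5 := D.le x
    refine ⟨abs_lt.2 ⟨by linarith, by linarith⟩, abs_lt.2 ⟨by linarith, by linarith⟩,
      by linarith, by linarith⟩
  · obtain ⟨δ, hδ, h⟩ := D.Pc z ε hε
    refine ⟨z, z + δ, by linarith, fun x h1 h2 => ?_⟩
    have h3 := D.P_mono h2
    have h4 := D.lt _ _ h1
    have h5 := D.le x
    refine ⟨abs_lt.2 ⟨by linarith, by linarith⟩, abs_lt.2 ⟨by linarith, by linarith⟩,
      by linarith, by linarith⟩

theorem K_perf {α : ℝ} (D : DJ α) : Perfect D.K := by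
  refine ⟨D.K_closed, ?_⟩
  rintro _ ⟨y, hy, rfl⟩
  simp only
  rw [accPt_iff_frequently, QuotientAddGroup.nhds_eq, Filter.frequently_map,
    Metric.nhds_basis_ball.frequently_iff]
  intro ε hε
  obtain ⟨a, b, hab, h⟩ := D.approx hy (lt_min hε one_pos)
  obtain ⟨h1, h2, h3, h4⟩ := h ((a + b) / 2) (by linarith) (by linarith)
  refine ⟨D.N ((a + b) / 2), ?_, ?_, (D.mem_K _).2 ⟨_, Or.inl rfl⟩⟩
  · rw [Metric.mem_ball, Real.dist_eq]; exact h1.trans_le (min_le_left _ _)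
  · intro he
    obtain ⟨m, hm⟩ := coe_eq.1 he.symm
    have h5 := h1.trans_le (min_le_right _ _)
    rw [hm, add_sub_cancel_left] at h5
    have h6 : |m| < 1 := by exact_mod_cast h5
    rw [Int.abs_lt_one_iff] at h6
    subst h6
    exact h3 (by simpa using hm)

theorem K_min {α : ℝ} (hα : Irrational α) (D : DJ α) : ∀ x ∈ D.K, ∀ y ∈ D.K,
    y ∈ closure {z | ∃ n : ℤ, (D.h.toEquiv ^ n) x = z} := by
  rintro _ ⟨x, hx, rfl⟩ _ ⟨y, hy, rfl⟩
  simp only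
  rw [mem_closure_iff_frequently, QuotientAddGroup.nhds_eq, Filter.frequently_map,
    Metric.nhds_basis_ball.frequently_iff]
  intro ε hε
  obtain ⟨a, b, hab, h⟩ := D.approx hy hε
  obtain ⟨t, ht⟩ := hx
  obtain ⟨n, m, h1, h2⟩ := dj_dense hα (show a - t < b - t by linarith)
  obtain ⟨h3, h4, -, -⟩ := h (t + n * α + m) (by linarith) (by linarith)
  refine ⟨(D.H ^ n) x + m, ?_, n, ?_⟩
  · rw [Metric.mem_ball, Real.dist_eq]
    rcases ht with rfl | rfl
    · rwa [D.Hz_N, ← add_int_of D.N_add]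
    · rwa [D.Hz_P, ← add_int_of D.P_add]
  · rw [D.hz_coe]
    exact coe_eq.2 ⟨m, rfl⟩

theorem K_inv {α : ℝ} (D : DJ α) : D.h '' D.K = D.K := by
  ext z
  induction z using QuotientAddGroup.induction_on with | _ y => ?_
  constructor
  · rintro ⟨_, ⟨x, hx, rfl⟩, hz⟩
    rw [← hz]
    exact (D.mem_K _).2 (D.Hz_Kt 1 hx)
  · intro hy
    have hy := D.Hz_Kt (-1) ((D.mem_K y).1 hy)
    refine ⟨_, ⟨_, hy, rfl⟩, ?_⟩
    show D.h (((D.H ^ (-1 : ℤ)) y : ℝ) : UnitAddCircle) = _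
    rw [h_coe]
    congr 1
    exact D.H.apply_symm_apply y

theorem rot {α : ℝ} (D : DJ α) :
    Filter.Tendsto (fun n : ℕ => D.H^[n] 0 / (n : ℝ)) Filter.atTop (nhds α) := by
  have e : ∀ n : ℕ, D.H^[n] 0 = D.P (n * α) := by
    intro n
    induction n with
    | zero => simp [D.P0]
    | succ n ih =>
      rw [Function.iterate_succ_apply', ih, H_apply, T_P _ D.good_pos]; push_cast; ring_nf
  have h0 : Tendsto (fun n : ℕ => D.H^[n] 0 / (n : ℝ) - α) atTop (𝓝 0) := by
    refine squeeze_zero_norm' ?_ tendsto_one_div_atTop_nhds_zero_nat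
    filter_upwards [eventually_gt_atTop 0] with n hn
    have hn : (0 : ℝ) < n := by exact_mod_cast hn
    rw [e, show D.P (n * α) / n - α = (D.P (n * α) - n * α) / n by field_simp, norm_div,
      Real.norm_eq_abs, Real.norm_eq_abs, abs_of_pos hn]
    exact div_le_div_of_nonneg_right (D.bd _) hn.le
  simpa using h0.add_const α

theorem code_per {α : ℝ} (D : DJ α) : Function.Periodic (fun (y : ℝ) (k : ℤ) =>
    if ⌊(D.H ^ (k + 1)) y⌋ - ⌊(D.H ^ k) y⌋ = 1 then (1 : Fin 2) else 0) 1 := by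
  intro y
  funext k
  simp only [D.Hz_add, Int.floor_add_one, add_sub_add_right_eq_sub]

/-- The Sturmian coding. -/
def code {α : ℝ} (D : DJ α) : UnitAddCircle → ℤ → Fin 2 := D.code_per.lift

theorem code_coe {α : ℝ} (D : DJ α) (y : ℝ) (k : ℤ) : D.code (y : UnitAddCircle) k =
    if ⌊(D.H ^ (k + 1)) y⌋ - ⌊(D.H ^ k) y⌋ = 1 then (1 : Fin 2) else 0 := rfl

theorem code_h {α : ℝ} (D : DJ α) (x : UnitAddCircle) : D.code (D.h x) = shift2 (D.code x) := by
  induction x using QuotientAddGroup.induction_on with | _ y => ?_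
  funext k
  show D.code (D.h (y : UnitAddCircle)) k = D.code (y : UnitAddCircle) (k + 1)
  rw [h_coe, code_coe, code_coe, zpow_add_one (D.H) (k + 1), zpow_add_one D.H k]
  rfl

theorem floor_const {α : ℝ} (D : DJ α) (y : ℝ) :
    ∀ᶠ z in 𝓝[D.Kt] y, ⌊z⌋ = ⌊y⌋ := by
  have key : ∀ z ∈ D.Kt, (⌊y⌋ : ℝ) + D.N 0 < z → (⌊y⌋ : ℝ) ≤ z := by
    intro z hz h
    by_contra! h2
    refine D.not_Kt (x := 0 + ⌊y⌋) ?_ ?_ hz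
    · rw [add_int_of D.N_add]; linarith
    · rw [add_int_of D.P_add, D.P0]; linarith
  have hn : D.N 0 < 0 := by simpa [D.P0] using D.gap0
  have h1 : (⌊y⌋ : ℝ) + D.N 0 < y := by linarith [Int.floor_le y]
  filter_upwards [self_mem_nhdsWithin,
    mem_nhdsWithin_of_mem_nhds (Ioo_mem_nhds h1 (Int.lt_floor_add_one y))] with z hz hz2
  rw [Int.floor_eq_iff]
  exact ⟨key z hz hz2.1, hz2.2⟩

theorem code_cont {α : ℝ} (D : DJ α) : ContinuousOn D.code D.K := by
  rintro _ ⟨y, hy, rfl⟩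
  refine tendsto_pi_nhds.2 fun k => ?_
  have hfl : ∀ k : ℤ, ∀ᶠ z in 𝓝[D.Kt] y, ⌊(D.H ^ k) z⌋ = ⌊(D.H ^ k) y⌋ := by
    intro k
    have ht : Tendsto (D.H ^ k) (𝓝[D.Kt] y) (𝓝[D.Kt] ((D.H ^ k) y)) := by
      refine tendsto_nhdsWithin_iff.2 ⟨((D.H ^ k).continuous.tendsto y).mono_left
        nhdsWithin_le_nhds, ?_⟩
      filter_upwards [self_mem_nhdsWithin] with z hz
      exact D.Hz_Kt k hz
    exact ht.eventually (D.floor_const ((D.H ^ k) y))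
  refine tendsto_const_nhds.congr' ?_
  show ∀ᶠ z in 𝓝[D.K] (y : UnitAddCircle), D.code (y : UnitAddCircle) k = D.code z k
  rw [eventually_nhdsWithin_iff, QuotientAddGroup.nhds_eq, Filter.eventually_map]
  have h1 := hfl k
  have h2 := hfl (k + 1)
  rw [eventually_nhdsWithin_iff] at h1 h2
  filter_upwards [h1, h2] with z h1 h2 hz
  have hz := (D.mem_K z).1 hz
  show D.code (y : UnitAddCircle) k = D.code (z : UnitAddCircle) k
  rw [code_coe, code_coe, h1 hz, h2 hz]

theorem floor_step {α : ℝ} (D : DJ α) (h0 : 0 < α) (h1 : α < 1) (y : ℝ) :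
    ⌊D.H y⌋ - ⌊y⌋ = 0 ∨ ⌊D.H y⌋ - ⌊y⌋ = 1 := by
  have e : D.H 0 = D.P α := by
    rw [H_apply, ← D.P0, T_P _ D.good_pos, zero_add]
  have a0 : 0 < D.P α := by have := D.P_mono h0; rwa [D.P0] at this
  have a1 : D.P α < 1 := by
    have := D.P_mono h1
    rwa [← zero_add (1 : ℝ), D.P_add, D.P0, zero_add] at this
  have hm : D.H (⌊y⌋ : ℝ) = D.P α + ⌊y⌋ := by
    have := D.Hz_add_int 1 ⌊y⌋ 0
    rw [zpow_one, e, zero_add] at this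
    exact this
  have hm1 : D.H ((⌊y⌋ : ℝ) + 1) = D.P α + ⌊y⌋ + 1 := by
    have := D.Hz_add 1 ⌊y⌋
    rw [zpow_one, hm] at this
    exact this
  have b1 := D.H.monotone (Int.floor_le y)
  have b2 := D.H.strictMono (Int.lt_floor_add_one y)
  have c1 : ⌊y⌋ ≤ ⌊D.H y⌋ := Int.le_floor.2 (by linarith)
  have c2 : ⌊D.H y⌋ < ⌊y⌋ + 2 := Int.floor_lt.2 (by push_cast; linarith)
  omega

theorem separate {α : ℝ} (hα : Irrational α) (D : DJ α) {y z : ℝ} (hz : z ∈ D.Kt)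
    (h : y < z) : ∃ k : ℤ, ⌊(D.H ^ k) y⌋ ≠ ⌊(D.H ^ k) z⌋ := by
  obtain ⟨n, m, h1, h2⟩ : ∃ n m : ℤ, y < D.P (n * α + m) ∧ D.P (n * α + m) ≤ z := by
    rcases (D.pi_mono h.le).lt_or_eq with hlt | heq
    · obtain ⟨n, m, h1, h2⟩ := dj_dense hα hlt
      refine ⟨n, m, (D.P_pi y).trans_lt (D.P_mono h1), ?_⟩
      linarith [D.lt _ _ h2, D.N_pi z]
    · have b1 := D.N_pi y
      have b2 := D.P_pi z
      rw [← heq] at b2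
      obtain ⟨n, m, hx⟩ := D.gap_orbit (D.pi y) (by linarith)
      refine ⟨n, m, ?_, ?_⟩
      · rw [← hx]; linarith
      · rw [← hx]
        by_contra! h3
        exact D.not_Kt (x := D.pi y) (by linarith) h3 hz
  refine ⟨-n, fun he => ?_⟩
  have e : (D.H ^ (-n)) (D.P (n * α + m)) = m := by
    rw [D.Hz_P]
    push_cast
    rw [show (n : ℝ) * α + m + -n * α = 0 + m by ring, add_int_of D.P_add, D.P0, zero_add]
  have a1 := (D.H ^ (-n)).strictMono h1
  have a2 := (D.H ^ (-n)).monotone h2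
  rw [e] at a1 a2
  have b1 := Int.floor_lt.2 a1
  have b2 := Int.le_floor.2 a2
  omega

theorem code_inj {α : ℝ} (hα : Irrational α) (D : DJ α) (h0 : 0 < α) (h1 : α < 1) :
    Set.InjOn D.code D.K := by
  rintro _ ⟨y, hy, rfl⟩ _ ⟨z, hz, rfl⟩ hc
  have step : ∀ k : ℤ, ⌊(D.H ^ (k + 1)) y⌋ - ⌊(D.H ^ k) y⌋ =
      ⌊(D.H ^ (k + 1)) z⌋ - ⌊(D.H ^ k) z⌋ := by
    intro k
    have a := congrFun hc k
    simp only [code_coe] at a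
    have b := D.floor_step h0 h1 ((D.H ^ k) y)
    have c := D.floor_step h0 h1 ((D.H ^ k) z)
    have e : ∀ y, D.H ((D.H ^ k) y) = (D.H ^ (k + 1)) y := by
      intro y; rw [add_comm, zpow_add, zpow_one]; rfl
    rw [e] at b c
    rcases b with b | b <;> rcases c with c | c <;> rw [b, c] at a ⊢ <;> simp at a
  have const : ∀ k : ℤ, ⌊(D.H ^ k) z⌋ - ⌊(D.H ^ k) y⌋ = ⌊z⌋ - ⌊y⌋ := by
    intro k
    induction k with
    | zero => simp
    | succ n ih => have := step n; omega
    | pred n ih =>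
      have := step (-n - 1)
      rw [sub_add_cancel] at this
      omega
  set c : ℤ := ⌊z⌋ - ⌊y⌋ with hcd
  have hyc : y + c ∈ D.Kt := by
    rw [← D.mem_K, ← coe_eq.2 ⟨c, rfl⟩, D.mem_K]; exact hy
  have eqf : ∀ k : ℤ, ⌊(D.H ^ k) (y + c)⌋ = ⌊(D.H ^ k) z⌋ := by
    intro k
    rw [D.Hz_add_int, Int.floor_add_intCast]
    have := const k
    omega
  refine coe_eq.2 ⟨c, ?_⟩
  rcases lt_trichotomy z (y + c) with h | h | h
  · obtain ⟨k, hk⟩ := D.separate hα hyc h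
    exact absurd (eqf k).symm hk
  · exact h
  · obtain ⟨k, hk⟩ := D.separate hα hz h
    exact absurd (eqf k) hk

theorem K_proper {α : ℝ} (D : DJ α) : D.K ≠ Set.univ := by
  intro h
  obtain ⟨c, h1, h2⟩ := exists_between D.gap0
  exact D.not_Kt h1 h2 ((D.mem_K c).1 (h ▸ Set.mem_univ _))

theorem code_emb {α : ℝ} (hα : Irrational α) (D : DJ α) (h0 : 0 < α) (h1 : α < 1) :
    Topology.IsEmbedding (fun x : D.K => D.code x) := by
  have : CompactSpace D.K := isCompact_iff_compactSpace.1 D.K_closed.isCompact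
  refine (Continuous.isClosedEmbedding ?_ ?_).isEmbedding
  · exact D.code_cont.domRestrict
  · exact (D.code_inj hα h0 h1).injective

theorem K_td {α : ℝ} (hα : Irrational α) (D : DJ α) (h0 : 0 < α) (h1 : α < 1) :
    IsTotallyDisconnected D.K := by
  have h := (D.code_emb hα h0 h1).isTotallyDisconnected (s := Set.univ)
    (isTotallyDisconnected_of_totallyDisconnectedSpace _)
  have h2 := Topology.IsEmbedding.subtypeVal.isTotallyDisconnected_image.2 h
  rwa [Set.image_univ, Subtype.range_coe] at h2

end DJ

/-- A `σ₂`-horseshoe of a homeomorphism `f` contains, for every irrational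
`α ∈ (0, 1/2)`, a weak Denjoy sub-system for `f` with rotation number `α`. -/
theorem sigma2_horseshoe_contains_WDS
    {M : Type*} [MetricSpace M] (f : M → M) (hf : IsHomeomorph f)
    (H : Set M) (k : (ℤ → Fin 2) → M) (hk : Topology.IsEmbedding k)
    (hrange : Set.range k = H) (hconj : ∀ u, f (k u) = k (shift2 u)) :
    ∀ α : ℝ, Irrational α → 0 < α → α < 1 / 2 →
      ∃ W : WDS M f, (W.rot : UnitAddCircle) = (α : UnitAddCircle) ∧ Set.range W.j ⊆ H := by
  intro α hα h0 h2
  have h1 : α < 1 := by linarith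
  obtain ⟨D⟩ := dj_exists hα
  have equi : ∀ x y : D.K, D.h (x : UnitAddCircle) = (y : UnitAddCircle) →
      k (D.code y) = f (k (D.code x)) := by
    intro x y hxy
    rw [hconj, ← D.code_h, hxy]
  let S : DenjoySystem :=
    { h := D.h
      K := D.K
      lift := D.H
      lift_mono := D.H.strictMono
      lift_cont := D.H.continuous
      lift_bij := D.H.bijective
      lift_add := D.T_add α
      lift_proj := fun x => rfl
      rot := α
      rot_lim := D.rot
      rot_irr := hα
      K_ne := ⟨_, _, ⟨0, Or.inl rfl⟩, rfl⟩
      K_cpt := D.K_closed.isCompact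
      K_proper := D.K_proper
      K_inv := D.K_inv
      K_perf := D.K_perf
      K_td := D.K_td hα h0 h1
      K_min := D.K_min hα }
  refine ⟨{ toDenjoySystem := S
            j := fun x => k (D.code x)
            j_emb := hk.comp (D.code_emb hα h0 h1)
            range_inv := ?_
            equivar := equi }, rfl, ?_⟩
  · ext z
    constructor
    · rintro ⟨_, ⟨x, rfl⟩, rfl⟩
      have hx : D.h x ∈ D.K := D.K_inv ▸ Set.mem_image_of_mem _ x.2
      exact ⟨⟨D.h x, hx⟩, equi x ⟨D.h x, hx⟩ rfl⟩
    · rintro ⟨y, rfl⟩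
      have hy : (y : UnitAddCircle) ∈ D.h '' D.K := D.K_inv.symm ▸ y.2
      obtain ⟨x, hx, hxy⟩ := hy
      exact ⟨_, ⟨⟨x, hx⟩, rfl⟩, (equi ⟨x, hx⟩ y hxy).symm⟩
  · rintro _ ⟨x, rfl⟩
    rw [← hrange]
    exact ⟨_, rfl⟩
end
end

section
/- Let M be a metric space, f : M → M a homeomorphism, and H ⊆ M a horseshoe for f, i.e. there exist p ≥ 1, a transition matrix A : Fin p × Fin p → {true, false} that is irreducible (for all i, j there exist n ≥ 1 and a finite sequence i = u₀, u₁, …, u_n = j with A(u_m, u_{m+1}) = true for all m < n), such that the subshift Σ_A = {u : ℤ → Fin p | ∀ k, A(u(k), u(k+1)) = true} is infinite, and a homeomorphism k : Σ_A → H (onto H) with f ∘ k = k ∘ σ_A, where σ_A is the shift. Then there exists N ≥ 1 such that for every irrational real α with 0 < α < 1/2 there exists a weak Denjoy sub-system (K_α, j_α, h_α) for f^N whose rotation number ρ(h_α) is the class of α in 𝕋 and such that j_α(K_α) ⊆ H. -/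
open Filter Topology Set

noncomputable section

/-- Irreducibility of a transition matrix: any symbol can be connected to any other
by an admissible word. -/
def MatIrreducible {p : ℕ} (A : Fin p → Fin p → Bool) : Prop :=
  ∀ i j : Fin p, ∃ n : ℕ, 1 ≤ n ∧ ∃ u : ℕ → Fin p, u 0 = i ∧ u n = j ∧
    ∀ m < n, A (u m) (u (m + 1)) = true

/-- The two-sided subshift of finite type associated to a transition matrix `A`. -/
def SubshiftSFT {p : ℕ} (A : Fin p → Fin p → Bool) : Set (ℤ → Fin p) :=
  {u | ∀ k : ℤ, A (u k) (u (k + 1)) = true}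

/-- `u` is an admissible path of length `n` from `i` to `j`. -/
def AdmPath {p : ℕ} (A : Fin p → Fin p → Bool) (n : ℕ) (u : ℕ → Fin p) (i j : Fin p) : Prop :=
  u 0 = i ∧ u n = j ∧ ∀ m < n, A (u m) (u (m + 1)) = true

lemma AdmPath.concat {p : ℕ} {A : Fin p → Fin p → Bool} {n m : ℕ} {u v : ℕ → Fin p}
    {i j l : Fin p} (hu : AdmPath A n u i j) (hv : AdmPath A m v j l) :
    ∃ w, AdmPath A (n + m) w i l ∧ ∀ r ≤ n, w r = u r := by
  obtain ⟨hu0, hun, hu⟩ := hu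
  obtain ⟨hv0, hvm, hv⟩ := hv
  refine ⟨fun r => if r ≤ n then u r else v (r - n), ⟨by simp [hu0], ?_, ?_⟩, ?_⟩
  · by_cases h : m = 0
    · subst h
      simp [hun, ← hvm, hv0]
    · simp [h, hvm]
  · intro r hr
    rcases lt_trichotomy r n with h | h | h
    · have h1 : r ≤ n := h.le
      have h2 : r + 1 ≤ n := h
      simpa [h1, h2] using hu r h
    · subst h
      have := hv 0 (by omega)
      simpa [hun, hv0] using this
    · have h1 : ¬ r ≤ n := by omega
      have h2 : ¬ r + 1 ≤ n := by omega
      have h3 : r + 1 - n = r - n + 1 := by omega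
      have := hv (r - n) (by omega)
      simpa [h1, h2, h3] using this
  · intro r hr
    simp [hr]

lemma exists_branch {p : ℕ} (A : Fin p → Fin p → Bool)
    (hA : MatIrreducible A) (hinf : (SubshiftSFT A).Infinite) :
    ∃ i a b, a ≠ b ∧ A i a = true ∧ A i b = true := by
  by_contra hcon
  push Not at hcon
  have huniq : ∀ i a b, A i a = true → A i b = true → a = b := by
    intro i a b ha hb
    by_contra hab
    exact hcon i a b hab ha hb
  have hsucc : ∀ i, ∃ a, A i a = true := by
    intro i
    obtain ⟨n, hn, u, h0, -, h⟩ := hA i i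
    exact ⟨u 1, by simpa [h0] using h 0 hn⟩
  choose s hs using hsucc
  have hsurj : Function.Surjective s := by
    intro j
    obtain ⟨n, hn, u, -, h1, h⟩ := hA j j
    refine ⟨u (n - 1), ?_⟩
    apply huniq _ _ _ (hs _)
    have := h (n - 1) (by omega)
    rwa [Nat.sub_add_cancel hn, h1] at this
  have hinj : Function.Injective s := Finite.injective_iff_surjective.2 hsurj
  apply hinf
  apply Set.Finite.of_injOn (f := fun u : ℤ → Fin p => u 0) (t := Set.univ)
    (fun _ _ => Set.mem_univ _) _ Set.finite_univ
  intro u hu v hv huv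
  have key : ∀ w ∈ SubshiftSFT A, ∀ k : ℤ, w (k + 1) = s (w k) :=
    fun w hw k => huniq _ _ _ (hw k) (hs _)
  funext k
  induction k using Int.induction_on with
  | zero => exact huv
  | succ n ih => rw [key u hu, key v hv, ih]
  | pred n ih =>
    apply hinj
    rw [← key u hu, ← key v hv]
    simpa using ih

lemma exists_words {p : ℕ} (A : Fin p → Fin p → Bool)
    (hA : MatIrreducible A) (hinf : (SubshiftSFT A).Infinite) :
    ∃ (N : ℕ) (i : Fin p) (w : Bool → ℕ → Fin p), 2 ≤ N ∧ (∀ b, AdmPath A N (w b) i i) ∧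
      w true 1 ≠ w false 1 := by
  obtain ⟨i, a, b, hab, ha, hb⟩ := exists_branch A hA hinf
  have loop : ∀ a, A i a = true → ∃ n u, 2 ≤ n ∧ AdmPath A n u i i ∧ u 1 = a := by
    intro a ha
    obtain ⟨n, hn, v, hv⟩ := hA a i
    have he : AdmPath A 1 (fun r => if r = 0 then i else a) i a :=
      ⟨by simp, by simp, fun m hm => by
        have : m = 0 := by omega
        subst this; simpa using ha⟩
    obtain ⟨w, hw, hw1⟩ := he.concat hv
    exact ⟨1 + n, w, by omega, hw, by simpa using hw1 1 le_rfl⟩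
  obtain ⟨n, u, hn, hu, hu1⟩ := loop a ha
  obtain ⟨m, v, hm, hv, hv1⟩ := loop b hb
  obtain ⟨x, hx, hx1⟩ := hu.concat hv
  obtain ⟨y, hy, hy1⟩ := hv.concat hu
  refine ⟨n + m, i, fun c => if c then x else y, by omega, ?_, ?_⟩
  · intro c
    cases c
    · simpa [add_comm] using hy
    · simpa using hx
  · simp only [if_true, Bool.false_eq_true, if_false]
    rw [hx1 1 (by omega), hy1 1 (by omega), hu1, hv1]
    exact hab

/-- The full 2-shift embeds in a power of the subshift. -/
lemma exists_full_shift {p : ℕ} (A : Fin p → Fin p → Bool)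
    (hA : MatIrreducible A) (hinf : (SubshiftSFT A).Infinite) :
    ∃ (N : ℕ) (E : (ℤ → Bool) → SubshiftSFT A), 1 ≤ N ∧ Continuous E ∧ Function.Injective E ∧
      ∀ s t : ℤ → Bool, (∀ n, t n = s (n + 1)) →
        ∀ n : ℤ, (E t : ℤ → Fin p) n = (E s : ℤ → Fin p) (n + N) := by
  obtain ⟨N, i, w, hN, hw, hne⟩ := exists_words A hA hinf
  have hN0 : (0 : ℤ) < N := by omega
  let F : (ℤ → Bool) → ℤ → Fin p := fun s t => w (s (t / N)) (t % N).toNat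
  have hF : ∀ s, F s ∈ SubshiftSFT A := by
    intro s t
    have h1 := Int.emod_nonneg t hN0.ne'
    have h2 := Int.emod_lt_of_pos t hN0
    have h3 := Int.mul_ediv_add_emod t N
    by_cases h : t % N + 1 < N
    · have hq : (t + 1) / N = t / N := by
        rw [Int.ediv_eq_iff_of_pos hN0]
        constructor <;> nlinarith
      have hr : (t + 1) % N = t % N + 1 := by
        rw [Int.emod_def, hq]; linarith
      have h4 : ((t % N) + 1).toNat = (t % N).toNat + 1 := by omega
      simp only [F, hq, hr, h4]
      exact (hw _).2.2 _ (by omega)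
    · have h5 : t % N + 1 = N := by omega
      have hq : (t + 1) / N = t / N + 1 := by
        rw [Int.ediv_eq_iff_of_pos hN0]
        constructor <;> nlinarith
      have hr : (t + 1) % N = 0 := by
        rw [Int.emod_def, hq]; linarith
      have h4 : (t % N).toNat + 1 = N := by omega
      have := (hw (s (t / N))).2.2 (t % N).toNat (by omega)
      rw [h4, (hw _).2.1] at this
      simp only [F, hq, hr, Int.toNat_zero, (hw _).1]
      exact this
  refine ⟨N, fun s => ⟨F s, hF s⟩, by omega, ?_, ?_, ?_⟩
  · apply Continuous.subtype_mk
    apply continuous_pi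
    intro t
    exact (continuous_of_discreteTopology (f := fun b : Bool => w b (t % N).toNat)).comp
      (continuous_apply (t / (N : ℤ)))
  · intro s t hst
    have hst' : F s = F t := congrArg Subtype.val hst
    funext q
    have := congrFun hst' (1 + N * q)
    have hq : (1 + N * q) / (N : ℤ) = q := by
      rw [Int.ediv_eq_iff_of_pos hN0]
      constructor <;> nlinarith
    have hr : (1 + N * q) % (N : ℤ) = 1 := by
      rw [Int.emod_def, hq]; ring
    simp only [F, hq, hr, Int.toNat_one] at this
    cases h1 : s q <;> cases h2 : t q <;> simp [h1, h2] at this ⊢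
    · exact hne this.symm
    · exact hne this
  · intro s t hst n
    simp only [F]
    rw [hst, Int.add_ediv_of_dvd_right (dvd_refl _), Int.ediv_self hN0.ne']
    simp

/-- A strictly monotone degree one function whose discontinuities are exactly `ℤ α + ℤ`. -/
lemma exists_jump_function (α : ℝ) : ∃ J : ℝ → ℝ, StrictMono J ∧ (∀ x, J (x + 1) = J x + 1) ∧
    ∀ x, ContinuousAt J x ↔ ¬ ∃ n m : ℤ, x = n * α + m := by
  let a : ℤ → ℝ := fun n => (1 / 2 : ℝ) ^ Encodable.encode n
  have ha : Summable a := summable_geometric_two_encode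
  have ha0 : ∀ n, 0 < a n := fun n => by positivity
  let g : ℝ → ℤ → ℝ := fun x n => a n * ((⌊x - n * α⌋ : ℝ) - ⌊-(n * α)⌋)
  have hbd : ∀ x n, ‖g x n‖ ≤ a n * (|x| + 1) := by
    intro x n
    simp only [g, norm_mul, Real.norm_eq_abs, abs_of_pos (ha0 n)]
    apply mul_le_mul_of_nonneg_left _ (ha0 n).le
    have h1 := Int.floor_le (x - n * α)
    have h2 := Int.lt_floor_add_one (x - n * α)
    have h3 := Int.floor_le (-(n * α))
    have h4 := Int.lt_floor_add_one (-(n * α))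
    have h5 := le_abs_self x
    have h6 := neg_abs_le x
    rw [abs_le]
    constructor <;> linarith
  have hs : ∀ x, Summable (g x) := fun x =>
    Summable.of_norm_bounded (ha.mul_right _) (hbd x)
  have hgm : ∀ n, Monotone fun x => g x n := by
    intro n x y hxy
    apply mul_le_mul_of_nonneg_left _ (ha0 n).le
    have : ⌊x - n * α⌋ ≤ ⌊y - n * α⌋ := Int.floor_mono (by linarith)
    have : (⌊x - n * α⌋ : ℝ) ≤ ⌊y - n * α⌋ := by exact_mod_cast this
    linarith
  let S : ℝ → ℝ := fun x => ∑' n, g x n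
  have hSm : Monotone S := fun x y hxy => (hs x).tsum_le_tsum (fun n => hgm n hxy) (hs y)
  let c : ℝ := 1 + ∑' n, a n
  have hc : 0 < c := by
    have : 0 ≤ ∑' n, a n := tsum_nonneg fun n => (ha0 n).le
    simp only [c]; linarith
  have hS1 : ∀ x, S (x + 1) = S x + ∑' n, a n := by
    intro x
    simp only [S]
    rw [← (hs x).tsum_add ha]
    congr 1
    funext n
    simp only [g]
    rw [show x + 1 - n * α = x - n * α + 1 by ring, Int.floor_add_one]
    push_cast
    ring
  refine ⟨fun x => (x + S x) / c, ?_, ?_, ?_⟩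
  · intro x y hxy
    have := hSm hxy.le
    show (x + S x) / c < (y + S y) / c
    exact div_lt_div_of_pos_right (by linarith) hc
  · intro x
    show (x + 1 + S (x + 1)) / c = (x + S x) / c + 1
    rw [hS1]
    field_simp
    simp only [c]
    ring
  · intro x
    constructor
    · rintro hcont ⟨k, m, rfl⟩
      set x : ℝ := k * α + m with hx
      have hScont : ContinuousAt S x := by
        have h2 : S = fun t => ((t + S t) / c) * c - t := by
          funext t
          field_simp
          ring
        rw [h2]
        exact (hcont.mul_const c).sub continuousAt_id
      have hjump : ∀ t < x, S t ≤ S x - a k := by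
        intro t ht
        have h1 : g t k + a k ≤ g x k := by
          simp only [g]
          have e1 : x - k * α = (m : ℝ) := by rw [hx]; ring
          have e2 : ⌊t - k * α⌋ < m := by
            rw [Int.floor_lt]; rw [hx] at ht; linarith
          have e3 : (⌊t - k * α⌋ : ℝ) + 1 ≤ m := by exact_mod_cast e2
          rw [e1, Int.floor_intCast]
          nlinarith [ha0 k]
        have h2 : S t + a k ≤ S x := by
          have : ∀ n, g t n + (if n = k then a k else 0) ≤ g x n := by
            intro n
            split_ifs with h
            · subst h; exact h1
            · simpa using hgm n ht.le
          have hsk : Summable fun n : ℤ => if n = k then a k else 0 :=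
            (hasSum_ite_eq k (a k)).summable
          have h3 := ((hs t).add hsk).tsum_le_tsum this (hs x)
          rw [(hs t).tsum_add hsk, tsum_ite_eq] at h3
          exact h3
        linarith
      have hle : S x ≤ S x - a k :=
        le_of_tendsto (hScont.tendsto.mono_left nhdsWithin_le_nhds : Tendsto S (𝓝[<] x) _)
          (eventually_nhdsWithin_of_forall hjump)
      linarith [ha0 k]
    · intro hx
      have : Tendsto S (𝓝 x) (𝓝 (S x)) := by
        apply tendsto_tsum_of_dominated_convergence (bound := fun n => a n * (|x| + 1 + 1))
          (ha.mul_right _)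
        · intro n
          have hev : ∀ᶠ t in 𝓝 x, g t n = g x n := by
            have h1 : (⌊x - n * α⌋ : ℝ) < x - n * α := by
              apply lt_of_le_of_ne (Int.floor_le _)
              intro h
              exact hx ⟨n, ⌊x - n * α⌋, by linarith⟩
            have h2 := Int.lt_floor_add_one (x - n * α)
            have h3 : ∀ᶠ t in 𝓝 x, (⌊x - n * α⌋ : ℝ) + n * α < t :=
              lt_mem_nhds (by linarith)
            have h4 : ∀ᶠ t in 𝓝 x, t < (⌊x - n * α⌋ : ℝ) + 1 + n * α :=
              gt_mem_nhds (by linarith)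
            filter_upwards [h3, h4] with t h3 h4
            have : ⌊t - n * α⌋ = ⌊x - n * α⌋ := by
              rw [Int.floor_eq_iff]
              constructor <;> linarith
            simp only [g, this]
          exact tendsto_const_nhds.congr' (hev.mono fun t ht => ht.symm)
        · have h1 : ∀ᶠ t in 𝓝 x, |t| < |x| + 1 :=
            (continuous_abs.tendsto x).eventually (gt_mem_nhds (by linarith))
          filter_upwards [h1] with t ht n
          refine (hbd t n).trans ?_
          apply mul_le_mul_of_nonneg_left _ (ha0 n).le
          linarith
      exact (tendsto_id.add this).div_const c

/-- Left and right limits of the jump function. -/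
structure Blowup (α : ℝ) (L R : ℝ → ℝ) : Prop where
  le : ∀ x, L x ≤ R x
  lt : ∀ x y, x < y → R x < L y
  L1 : ∀ x, L (x + 1) = L x + 1
  R1 : ∀ x, R (x + 1) = R x + 1
  gap : ∀ x, L x < R x ↔ ∃ n m : ℤ, x = n * α + m
  cover : ∀ y, ∃ x, L x ≤ y ∧ y ≤ R x
  right : ∀ t, ∀ ε > 0, ∃ s > t, L s < R t + ε
  left : ∀ t, ∀ ε > 0, ∃ s < t, L t - ε < R s

lemma exists_blowup (α : ℝ) : ∃ L R, Blowup α L R := by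
  obtain ⟨J, hJ, hJ1, hJc⟩ := exists_jump_function α
  have hm := hJ.monotone
  have hiter : ∀ n : ℕ, J n = J 0 + n ∧ J (-n) = J 0 - n := by
    intro n
    induction n with
    | zero => simp
    | succ n ih =>
      constructor
      · push_cast
        rw [hJ1, ih.1]; ring
      · have := hJ1 (-(n + 1 : ℝ))
        rw [show -(n + 1 : ℝ) + 1 = -n by ring, ih.2] at this
        push_cast
        linarith
  refine ⟨Function.leftLim J, Function.rightLim J, ?_, ?_, ?_, ?_, ?_, ?_, ?_, ?_⟩
  · intro x
    exact hm.leftLim_le_rightLim le_rfl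
  · intro x y hxy
    obtain ⟨u, hu1, hu2⟩ := exists_between hxy
    obtain ⟨v, hv1, hv2⟩ := exists_between hu2
    exact (hm.rightLim_le hu1).trans_lt ((hJ hv1).trans_le (hm.le_leftLim hv2))
  · intro x
    have h1 : Tendsto (fun t => J (t + 1)) (𝓝[<] x) (𝓝 (Function.leftLim J (x + 1))) := by
      apply (hm.tendsto_leftLim (x + 1)).comp
      apply tendsto_nhdsWithin_of_tendsto_nhds_of_eventually_within
      · exact ((continuous_id.add continuous_const).tendsto x).mono_left nhdsWithin_le_nhds
      · exact eventually_nhdsWithin_of_forall fun t ht => by simpa using ht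
    have h2 : Tendsto (fun t => J (t + 1)) (𝓝[<] x) (𝓝 (Function.leftLim J x + 1)) := by
      simp only [hJ1]
      exact (hm.tendsto_leftLim x).add_const 1
    exact tendsto_nhds_unique h1 h2
  · intro x
    have h1 : Tendsto (fun t => J (t + 1)) (𝓝[>] x) (𝓝 (Function.rightLim J (x + 1))) := by
      apply (hm.tendsto_rightLim (x + 1)).comp
      apply tendsto_nhdsWithin_of_tendsto_nhds_of_eventually_within
      · exact ((continuous_id.add continuous_const).tendsto x).mono_left nhdsWithin_le_nhds
      · exact eventually_nhdsWithin_of_forall fun t ht => by simpa using ht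
    have h2 : Tendsto (fun t => J (t + 1)) (𝓝[>] x) (𝓝 (Function.rightLim J x + 1)) := by
      simp only [hJ1]
      exact (hm.tendsto_rightLim x).add_const 1
    exact tendsto_nhds_unique h1 h2
  · intro x
    rw [← not_iff_not, ← hJc, hm.continuousAt_iff_leftLim_eq_rightLim, not_lt]
    exact ⟨fun h => le_antisymm (hm.leftLim_le_rightLim le_rfl) h, fun h => h.ge⟩
  · intro y
    let T := {t | J t ≤ y}
    have hne : T.Nonempty := by
      obtain ⟨n, hn⟩ := exists_nat_gt (J 0 - y)
      exact ⟨-n, by show J (-n) ≤ y; rw [(hiter n).2]; linarith⟩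
    have hbdd : BddAbove T := by
      obtain ⟨n, hn⟩ := exists_nat_gt (y - J 0)
      refine ⟨n, fun t ht => ?_⟩
      by_contra h
      have h1 := hJ (not_le.1 h)
      rw [(hiter n).1] at h1
      have h2 : J t ≤ y := ht
      linarith
    refine ⟨sSup T, ?_, ?_⟩
    · refine le_of_tendsto (hm.tendsto_leftLim _) (eventually_nhdsWithin_of_forall ?_)
      intro t ht
      obtain ⟨s, hs, hts⟩ := exists_lt_of_lt_csSup hne ht
      exact (hm hts.le).trans hs
    · refine ge_of_tendsto (hm.tendsto_rightLim _) (eventually_nhdsWithin_of_forall ?_)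
      intro t ht
      by_contra h
      exact absurd (le_csSup hbdd (show t ∈ T from (not_le.1 h).le)) (not_le.2 ht)
  · intro t ε hε
    have h := (hm.tendsto_rightLim t).eventually
      (gt_mem_nhds (show Function.rightLim J t < Function.rightLim J t + ε by linarith))
    obtain ⟨s, hs1, hs2⟩ := (h.and self_mem_nhdsWithin).exists
    exact ⟨s, hs2, (hm.leftLim_le le_rfl).trans_lt hs1⟩
  · intro t ε hε
    have h := (hm.tendsto_leftLim t).eventually
      (lt_mem_nhds (show Function.leftLim J t - ε < Function.leftLim J t by linarith))
    obtain ⟨s, hs1, hs2⟩ := (h.and self_mem_nhdsWithin).exists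
    exact ⟨s, hs2, hs1.trans_le (hm.le_rightLim le_rfl)⟩

namespace Blowup

variable {α : ℝ} {L R : ℝ → ℝ}

/-- The collapsing map. -/
def phi (B : Blowup α L R) (y : ℝ) : ℝ := Classical.choose (B.cover y)

lemma L_phi_le (B : Blowup α L R) (y : ℝ) : L (B.phi y) ≤ y := (Classical.choose_spec (B.cover y)).1

lemma le_R_phi (B : Blowup α L R) (y : ℝ) : y ≤ R (B.phi y) := (Classical.choose_spec (B.cover y)).2

lemma phi_eq (B : Blowup α L R) {x y : ℝ} (h1 : L x ≤ y) (h2 : y ≤ R x) : B.phi y = x := by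
  rcases lt_trichotomy (B.phi y) x with h | h | h
  · linarith [B.lt _ _ h, B.le_R_phi y]
  · exact h
  · linarith [B.lt _ _ h, B.L_phi_le y]

lemma phi_L (B : Blowup α L R) (x : ℝ) : B.phi (L x) = x := B.phi_eq le_rfl (B.le x)

lemma phi_R (B : Blowup α L R) (x : ℝ) : B.phi (R x) = x := B.phi_eq (B.le x) le_rfl

lemma phi_mono (B : Blowup α L R) : Monotone B.phi := by
  intro y z h
  by_contra hc
  linarith [B.lt _ _ (not_le.1 hc), B.le_R_phi z, B.L_phi_le y]

lemma phi_add_one (B : Blowup α L R) (y : ℝ) : B.phi (y + 1) = B.phi y + 1 := by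
  apply B.phi_eq
  · rw [B.L1]; linarith [B.L_phi_le y]
  · rw [B.R1]; linarith [B.le_R_phi y]

lemma gap_add (B : Blowup α L R) {x : ℝ} : L (x + α) < R (x + α) ↔ L x < R x := by
  rw [B.gap, B.gap]
  constructor
  · rintro ⟨n, m, h⟩
    exact ⟨n - 1, m, by push_cast; linarith⟩
  · rintro ⟨n, m, h⟩
    exact ⟨n + 1, m, by push_cast; linarith⟩

/-- Affine extension in the gaps. -/
def G (B : Blowup α L R) (y : ℝ) : ℝ :=
  L (B.phi y + α) +
    (R (B.phi y + α) - L (B.phi y + α)) / (R (B.phi y) - L (B.phi y)) * (y - L (B.phi y))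

lemma G_L (B : Blowup α L R) (x : ℝ) : B.G (L x) = L (x + α) := by
  simp [G, B.phi_L]

lemma G_R (B : Blowup α L R) (x : ℝ) : B.G (R x) = R (x + α) := by
  simp only [G, B.phi_R]
  rcases (B.le x).lt_or_eq with h | h
  · rw [div_mul_cancel₀ _ (by linarith)]; ring
  · have h2 : ¬ L (x + α) < R (x + α) := by rw [B.gap_add]; linarith
    have h3 := B.le (x + α)
    rw [h]
    simp
    linarith

lemma G_strictMono (B : Blowup α L R) : StrictMono B.G := by
  have aux : ∀ y, L (B.phi y + α) ≤ B.G y ∧ B.G y ≤ R (B.phi y + α) := by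
    intro y
    have h1 := B.L_phi_le y
    have h2 := B.le_R_phi y
    have h3 := B.le (B.phi y + α)
    rcases (B.le (B.phi y)).lt_or_eq with h | h
    · have h5 : 0 < R (B.phi y) - L (B.phi y) := by linarith
      have h4 : 0 ≤ (R (B.phi y + α) - L (B.phi y + α)) / (R (B.phi y) - L (B.phi y)) :=
        div_nonneg (by linarith) h5.le
      constructor
      · have := mul_nonneg h4 (sub_nonneg.2 h1)
        simp only [G]; linarith
      · have := mul_le_mul_of_nonneg_left (show y - L (B.phi y) ≤ R (B.phi y) - L (B.phi y) by linarith) h4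
        rw [div_mul_cancel₀ _ h5.ne'] at this
        simp only [G]; linarith
    · have : y = L (B.phi y) := by linarith
      have h6 : B.G y = L (B.phi y + α) := by
        rw [G, sub_eq_zero.2 this]; simp
      rw [h6]
      exact ⟨le_rfl, h3⟩
  intro y z hyz
  rcases (B.phi_mono hyz.le).lt_or_eq with h | h
  · calc B.G y ≤ R (B.phi y + α) := (aux y).2
      _ < L (B.phi z + α) := B.lt _ _ (by linarith)
      _ ≤ B.G z := (aux z).1
  · have h1 := B.L_phi_le y
    have h2 := B.le_R_phi z
    rw [← h] at h2
    have h3 : L (B.phi y) < R (B.phi y) := by linarith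
    have h4 := B.gap_add.2 h3
    simp only [G, ← h]
    have h5 : 0 < (R (B.phi y + α) - L (B.phi y + α)) / (R (B.phi y) - L (B.phi y)) :=
      div_pos (by linarith) (by linarith)
    have := mul_lt_mul_of_pos_left (show y - L (B.phi y) < z - L (B.phi y) by linarith) h5
    linarith

lemma phi_G (B : Blowup α L R) (y : ℝ) : B.phi (B.G y) = B.phi y + α := by
  apply B.phi_eq
  · rw [← B.G_L]; exact B.G_strictMono.monotone (B.L_phi_le y)
  · rw [← B.G_R]; exact B.G_strictMono.monotone (B.le_R_phi y)

lemma G_surj (B : Blowup α L R) : Function.Surjective B.G := by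
  intro z
  obtain ⟨x, hx⟩ : ∃ x, B.phi z = x + α := ⟨B.phi z - α, by ring⟩
  have h1 := B.L_phi_le z
  have h2 := B.le_R_phi z
  rw [hx] at h1 h2
  rcases h1.eq_or_lt with h | h
  · exact ⟨L x, by rw [B.G_L, h]⟩
  have h3 : L (x + α) < R (x + α) := by linarith
  have h4 := B.gap_add.1 h3
  have h5 : 0 < R x - L x := by linarith
  have h6 : 0 < R (x + α) - L (x + α) := by linarith
  have h7 : B.phi (L x + (R x - L x) / (R (x + α) - L (x + α)) * (z - L (x + α))) = x := by
    apply B.phi_eq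
    · have : 0 ≤ (R x - L x) / (R (x + α) - L (x + α)) * (z - L (x + α)) :=
        mul_nonneg (div_nonneg h5.le h6.le) (by linarith)
      linarith
    · have := mul_le_mul_of_nonneg_left (show z - L (x + α) ≤ R (x + α) - L (x + α) by linarith)
        (div_nonneg h5.le h6.le)
      rw [div_mul_cancel₀ _ h6.ne'] at this
      linarith
  refine ⟨L x + (R x - L x) / (R (x + α) - L (x + α)) * (z - L (x + α)), ?_⟩
  rw [G, h7]
  field_simp
  ring

lemma G_add_one (B : Blowup α L R) (y : ℝ) : B.G (y + 1) = B.G y + 1 := by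
  simp only [G, B.phi_add_one]
  rw [show B.phi y + 1 + α = B.phi y + α + 1 by ring]
  simp only [B.L1, B.R1]
  rw [show R (B.phi y + α) + 1 - (L (B.phi y + α) + 1) = R (B.phi y + α) - L (B.phi y + α) by ring,
    show R (B.phi y) + 1 - (L (B.phi y) + 1) = R (B.phi y) - L (B.phi y) by ring,
    show y + 1 - (L (B.phi y) + 1) = y - L (B.phi y) by ring]
  ring

/-- The lifted Cantor set. -/
def Kt (B : Blowup α L R) : Set ℝ := {y | y = L (B.phi y) ∨ y = R (B.phi y)}

lemma not_mem_Kt (B : Blowup α L R) {y : ℝ} : y ∉ B.Kt ↔ ∃ x, L x < y ∧ y < R x := by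
  constructor
  · intro h
    simp only [Kt, mem_ofPred_eq, not_or] at h
    exact ⟨B.phi y, lt_of_le_of_ne (B.L_phi_le y) (Ne.symm h.1), lt_of_le_of_ne (B.le_R_phi y) h.2⟩
  · rintro ⟨x, h1, h2⟩ h
    have h3 := B.phi_eq h1.le h2.le
    rcases h with h | h <;> rw [h3] at h <;> linarith

lemma Kt_closed (B : Blowup α L R) : IsClosed B.Kt := by
  rw [← isOpen_compl_iff]
  have : B.Ktᶜ = ⋃ x, Ioo (L x) (R x) := by
    ext y
    rw [mem_compl_iff, B.not_mem_Kt]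
    simp
  rw [this]
  exact isOpen_iUnion fun _ => isOpen_Ioo

lemma L_mem (B : Blowup α L R) (x : ℝ) : L x ∈ B.Kt := Or.inl (by rw [B.phi_L])

lemma R_mem (B : Blowup α L R) (x : ℝ) : R x ∈ B.Kt := Or.inr (by rw [B.phi_R])

lemma mem_Kt_iff (B : Blowup α L R) {y : ℝ} : y ∈ B.Kt ↔ (∃ x, y = L x) ∨ ∃ x, y = R x := by
  constructor
  · rintro (h | h)
    · exact Or.inl ⟨_, h⟩
    · exact Or.inr ⟨_, h⟩
  · rintro (⟨x, rfl⟩ | ⟨x, rfl⟩)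
    · exact B.L_mem x
    · exact B.R_mem x

lemma G_mem (B : Blowup α L R) {y : ℝ} : B.G y ∈ B.Kt ↔ y ∈ B.Kt := by
  constructor
  · intro h
    by_contra hy
    obtain ⟨x, h1, h2⟩ := B.not_mem_Kt.1 hy
    apply B.not_mem_Kt.2 ⟨x + α, ?_, ?_⟩ h
    · rw [← B.G_L]; exact B.G_strictMono h1
    · rw [← B.G_R]; exact B.G_strictMono h2
  · intro h
    rcases B.mem_Kt_iff.1 h with ⟨x, rfl⟩ | ⟨x, rfl⟩
    · rw [B.G_L]; exact B.L_mem _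
    · rw [B.G_R]; exact B.R_mem _

lemma L_add_int (B : Blowup α L R) (x : ℝ) (m : ℤ) : L (x + m) = L x + m := by
  induction m using Int.induction_on with
  | zero => simp
  | succ n ih => 
    push_cast at ih ⊢
    rw [← add_assoc, B.L1, ih]; ring
  | pred n ih =>
    push_cast at ih ⊢
    have := B.L1 (x + (-n - 1))
    rw [show x + (-n - 1 : ℝ) + 1 = x + -n by ring, ih] at this
    linarith

lemma R_add_int (B : Blowup α L R) (x : ℝ) (m : ℤ) : R (x + m) = R x + m := by
  induction m using Int.induction_on with
  | zero => simp
  | succ n ih => 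
    push_cast at ih ⊢
    rw [← add_assoc, B.R1, ih]; ring
  | pred n ih =>
    push_cast at ih ⊢
    have := B.R1 (x + (-n - 1))
    rw [show x + (-n - 1 : ℝ) + 1 = x + -n by ring, ih] at this
    linarith

lemma phi_add_int (B : Blowup α L R) (y : ℝ) (m : ℤ) : B.phi (y + m) = B.phi y + m := by
  apply B.phi_eq
  · rw [B.L_add_int]; linarith [B.L_phi_le y]
  · rw [B.R_add_int]; linarith [B.le_R_phi y]

lemma Kt_add_int (B : Blowup α L R) {y : ℝ} (h : y ∈ B.Kt) (m : ℤ) : y + m ∈ B.Kt := by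
  rcases B.mem_Kt_iff.1 h with ⟨x, rfl⟩ | ⟨x, rfl⟩
  · rw [← B.L_add_int]; exact B.L_mem _
  · rw [← B.R_add_int]; exact B.R_mem _

/-- The lift as an order isomorphism. -/
def e (B : Blowup α L R) : ℝ ≃o ℝ := StrictMono.orderIsoOfSurjective B.G B.G_strictMono B.G_surj

@[simp] lemma e_apply (B : Blowup α L R) (y : ℝ) : B.e y = B.G y := rfl

lemma phi_zpow (B : Blowup α L R) (n : ℤ) (y : ℝ) :
    B.phi ((B.e.toEquiv ^ n : Equiv.Perm ℝ) y) = B.phi y + n * α := by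
  have hstep : ∀ z, B.phi (B.e.toEquiv.symm z) = B.phi z - α := by
    intro z
    have h := B.phi_G (B.e.toEquiv.symm z)
    have h2 : B.G (B.e.toEquiv.symm z) = z := B.e.apply_symm_apply z
    rw [h2] at h
    linarith
  induction n using Int.induction_on generalizing y with
  | zero => simp
  | succ n ih =>
    rw [zpow_add_one, Equiv.Perm.mul_apply, ih]
    have : B.phi (B.e.toEquiv y) = B.phi y + α := B.phi_G y
    rw [this]; push_cast; ring
  | pred n ih =>
    rw [zpow_sub_one, Equiv.Perm.mul_apply, ih, Equiv.Perm.inv_def, hstep]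
    push_cast; ring

lemma zpow_mem (B : Blowup α L R) (n : ℤ) (y : ℝ) :
    (B.e.toEquiv ^ n : Equiv.Perm ℝ) y ∈ B.Kt ↔ y ∈ B.Kt := by
  have hstep : ∀ z, B.e.toEquiv.symm z ∈ B.Kt ↔ z ∈ B.Kt := by
    intro z
    have h2 : B.G (B.e.toEquiv.symm z) = z := B.e.apply_symm_apply z
    rw [← B.G_mem, h2]
  induction n using Int.induction_on generalizing y with
  | zero => simp
  | succ n ih =>
    rw [zpow_add_one, Equiv.Perm.mul_apply]
    exact (ih _).trans B.G_mem
  | pred n ih =>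
    rw [zpow_sub_one, Equiv.Perm.mul_apply, Equiv.Perm.inv_def]
    exact (ih _).trans (hstep _)

lemma zpow_strictMono (B : Blowup α L R) (n : ℤ) :
    StrictMono (B.e.toEquiv ^ n : Equiv.Perm ℝ) := by
  induction n using Int.induction_on with
  | zero => exact strictMono_id
  | succ n ih =>
    rw [zpow_add_one]
    exact ih.comp B.e.strictMono
  | pred n ih =>
    rw [zpow_sub_one]
    exact ih.comp B.e.symm.strictMono

lemma dense_aux (hα : Irrational α) {a b : ℝ} (hab : a < b) (t : ℝ) :
    ∃ n m : ℤ, t + n * α + m ∈ Ioo a b := by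
  have hd : Dense (AddSubgroup.closure {α, (1 : ℝ)} : Set ℝ) :=
    dense_addSubgroupClosure_pair_iff.2 (by simpa using hα)
  obtain ⟨z, hz, h1, h2⟩ := hd.exists_between (show a - t < b - t by linarith)
  obtain ⟨n, m, rfl⟩ := AddSubgroup.mem_closure_pair.1 hz
  simp only [zsmul_eq_mul, mul_one] at h1 h2
  exact ⟨n, m, by linarith, by linarith⟩

/-- Orbits accumulate everywhere on `Kt`. -/
lemma approx (B : Blowup α L R) (hα : Irrational α) {y : ℝ} (hy : y ∈ B.Kt) (x : ℝ) {ε : ℝ}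
    (hε : 0 < ε) : ∃ n m : ℤ, |(B.e.toEquiv ^ n : Equiv.Perm ℝ) x + m - y| < ε ∧
      B.phi ((B.e.toEquiv ^ n : Equiv.Perm ℝ) x + m) ≠ B.phi y ∧
      |B.phi ((B.e.toEquiv ^ n : Equiv.Perm ℝ) x + m) - B.phi y| < 1 := by
  rcases B.mem_Kt_iff.1 hy with ⟨t, rfl⟩ | ⟨t, rfl⟩
  · obtain ⟨s, hs, hs2⟩ := B.left t ε hε
    obtain ⟨n, m, h1, h2⟩ := dense_aux hα (max_lt hs (show t - 1 < t by linarith)) (B.phi x)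
    have h3 := max_lt_iff.1 h1
    refine ⟨n, m, ?_, ?_⟩
    · set z := (B.e.toEquiv ^ n : Equiv.Perm ℝ) x + m with hz
      have hphi : B.phi z = B.phi x + n * α + m := by rw [hz, B.phi_add_int, B.phi_zpow]
      have h4 := B.lt _ _ (hphi ▸ h3.1)
      have h5 := B.lt _ _ (hphi ▸ h2)
      have h6 := B.L_phi_le z
      have h7 := B.le_R_phi z
      rw [abs_lt]; constructor <;> linarith
    · rw [B.phi_add_int, B.phi_zpow, B.phi_L]
      exact ⟨h2.ne, by rw [abs_lt]; constructor <;> linarith⟩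
  · obtain ⟨s, hs, hs2⟩ := B.right t ε hε
    obtain ⟨n, m, h1, h2⟩ := dense_aux hα (lt_min hs (show t < t + 1 by linarith)) (B.phi x)
    have h3 := lt_min_iff.1 h2
    refine ⟨n, m, ?_, ?_⟩
    · set z := (B.e.toEquiv ^ n : Equiv.Perm ℝ) x + m with hz
      have hphi : B.phi z = B.phi x + n * α + m := by rw [hz, B.phi_add_int, B.phi_zpow]
      have h4 := B.lt _ _ (hphi ▸ h3.1)
      have h5 := B.lt _ _ (hphi ▸ h1)
      have h6 := B.L_phi_le z
      have h7 := B.le_R_phi z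
      rw [abs_lt]; constructor <;> linarith
    · rw [B.phi_add_int, B.phi_zpow, B.phi_R]
      exact ⟨h1.ne', by rw [abs_lt]; constructor <;> linarith⟩

lemma tendsto_rot (B : Blowup α L R) :
    Tendsto (fun n : ℕ => B.G^[n] 0 / (n : ℝ)) atTop (𝓝 α) := by
  let F : CircleDeg1Lift := ⟨⟨B.G, B.G_strictMono.monotone⟩, B.G_add_one⟩
  let P : CircleDeg1Lift := ⟨⟨B.phi, B.phi_mono⟩, B.phi_add_one⟩
  have h1 : Function.Semiconj P F
      (CircleDeg1Lift.translate (Multiplicative.ofAdd α) : CircleDeg1Lift) := by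
    intro y
    rw [CircleDeg1Lift.translate_apply]
    show B.phi (B.G y) = α + B.phi y
    rw [B.phi_G, add_comm]
  have h2 := CircleDeg1Lift.translationNumber_eq_of_semiconj h1
  rw [CircleDeg1Lift.translationNumber_translate] at h2
  have h3 := F.tendsto_translation_number₀
  rw [h2] at h3
  simp only [CircleDeg1Lift.coe_pow] at h3
  exact h3

end Blowup

lemma coe_eq_coe_iff_int {x y : ℝ} : (x : UnitAddCircle) = (y : UnitAddCircle) ↔
    ∃ m : ℤ, y = x + m := by
  rw [eq_comm, ← sub_eq_zero, ← AddCircle.coe_sub, AddCircle.coe_eq_zero_iff]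
  constructor
  · rintro ⟨n, hn⟩
    exact ⟨n, by simp at hn; linarith⟩
  · rintro ⟨n, rfl⟩
    exact ⟨n, by simp⟩

lemma coe_add_int (x : ℝ) (m : ℤ) : ((x + m : ℝ) : UnitAddCircle) = (x : UnitAddCircle) :=
  (coe_eq_coe_iff_int.2 ⟨m, rfl⟩).symm

/-- A degree one homeomorphism of the line descends to the circle. -/
lemma exists_circle_homeo (e : ℝ ≃ₜ ℝ) (he : ∀ x, e (x + 1) = e x + 1) :
    ∃ h : UnitAddCircle ≃ₜ UnitAddCircle, ∀ x : ℝ, h (x : UnitAddCircle) = ((e x : ℝ) : UnitAddCircle) := by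
  have he' : ∀ x, e.symm (x + 1) = e.symm x + 1 := by
    intro x
    apply e.injective
    rw [he]; simp
  have desc : ∀ g : ℝ ≃ₜ ℝ, (∀ x, g (x + 1) = g x + 1) → ∃ h : UnitAddCircle → UnitAddCircle,
      Continuous h ∧ ∀ x : ℝ, h (x : UnitAddCircle) = ((g x : ℝ) : UnitAddCircle) := by
    intro g hg
    have hper : Function.Periodic (fun x : ℝ => ((g x : ℝ) : UnitAddCircle)) 1 := by
      intro x
      simp only [hg]
      exact AddCircle.coe_add_period 1 _
    refine ⟨hper.lift, ?_, fun x => hper.lift_coe x⟩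
    apply (QuotientAddGroup.isQuotientMap_mk (AddSubgroup.zmultiples (1 : ℝ))).continuous_iff.2
    exact (AddCircle.continuous_mk' 1).comp g.continuous
  obtain ⟨h, hc, hh⟩ := desc e he
  obtain ⟨h', hc', hh'⟩ := desc e.symm he'
  refine ⟨⟨⟨h, h', ?_, ?_⟩, hc, hc'⟩, hh⟩
  · intro z
    obtain ⟨x, rfl⟩ := QuotientAddGroup.mk_surjective z
    erw [hh, hh']; simp
  · intro z
    obtain ⟨x, rfl⟩ := QuotientAddGroup.mk_surjective z
    erw [hh', hh]; simp

/-- Denjoy example with rotation number `α` together with a Sturmian coding. -/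
lemma exists_denjoy (α : ℝ) (hα : Irrational α) (h0 : 0 < α) (h1 : α < 1) :
    ∃ (D : DenjoySystem) (c : D.K → ℤ → Bool), D.rot = α ∧ Continuous c ∧ Function.Injective c ∧
      ∀ x y : D.K, D.h x = y → ∀ n, c y n = c x (n + 1) := by
  obtain ⟨L, R, B⟩ := exists_blowup α
  obtain ⟨h, hh⟩ := exists_circle_homeo B.e.toHomeomorph B.G_add_one
  have hpow : ∀ (n : ℤ) (x : ℝ), (h.toEquiv ^ n : Equiv.Perm UnitAddCircle) (x : UnitAddCircle) =
      (((B.e.toEquiv ^ n : Equiv.Perm ℝ) x : ℝ) : UnitAddCircle) := by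
    have hstep : ∀ x : ℝ, h.toEquiv.symm (x : UnitAddCircle) =
        ((B.e.toEquiv.symm x : ℝ) : UnitAddCircle) := by
      intro x
      rw [Equiv.symm_apply_eq]
      have := hh (B.e.toEquiv.symm x)
      refine Eq.trans ?_ this.symm
      congr 1
      exact (B.e.apply_symm_apply x).symm
    intro n
    induction n using Int.induction_on with
    | zero => intro x; simp
    | succ n ih =>
      intro x
      rw [zpow_add_one, zpow_add_one, Equiv.Perm.mul_apply, Equiv.Perm.mul_apply, ← ih]
      congr 1
      exact hh x
    | pred n ih =>
      intro x
      rw [zpow_sub_one, zpow_sub_one, Equiv.Perm.mul_apply, Equiv.Perm.mul_apply, ← ih]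
      congr 1
      exact hstep x
  let K : Set UnitAddCircle := (fun x : ℝ => (x : UnitAddCircle)) '' B.Kt
  have hKmem : ∀ x : ℝ, (x : UnitAddCircle) ∈ K ↔ x ∈ B.Kt := by
    intro x
    constructor
    · rintro ⟨y, hy, hxy⟩
      obtain ⟨m, rfl⟩ := coe_eq_coe_iff_int.1 hxy
      exact B.Kt_add_int hy m
    · intro hx
      exact ⟨x, hx, rfl⟩
  have hKclosed : IsClosed K := by
    rw [← (QuotientAddGroup.isQuotientMap_mk (AddSubgroup.zmultiples (1 : ℝ))).isClosed_preimage]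
    convert B.Kt_closed using 1
    ext x
    exact hKmem x
  have hKpow : ∀ (n : ℤ) (z : UnitAddCircle), z ∈ K →
      (h.toEquiv ^ n : Equiv.Perm UnitAddCircle) z ∈ K := by
    rintro n _ ⟨x, hx, rfl⟩
    rw [hpow, hKmem]
    exact (B.zpow_mem n x).2 hx
  have hcoe : Continuous (fun x : ℝ => (x : UnitAddCircle)) := AddCircle.continuous_mk' 1
  have hopen : IsOpenMap (fun x : ℝ => (x : UnitAddCircle)) := QuotientAddGroup.isOpenMap_coe
  -- gaps
  have g0 : L 0 < R 0 := (B.gap 0).2 ⟨0, 0, by simp⟩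
  have gα : L α < R α := (B.gap α).2 ⟨1, 0, by simp⟩
  have l0 : R 0 < L α := B.lt _ _ h0
  have l1 : R α < L 1 := B.lt _ _ h1
  have eL1 : L 1 = L 0 + 1 := by simpa using B.L1 0
  have eR1 : R 1 = R 0 + 1 := by simpa using B.R1 0
  have nogap : ∀ y ∈ B.Kt, ∀ x, y ≤ L x ∨ R x ≤ y := by
    intro y hy x
    by_contra hcon
    push Not at hcon
    exact B.not_mem_Kt.2 ⟨x, hcon⟩ hy
  let U : Set UnitAddCircle := (fun x : ℝ => (x : UnitAddCircle)) '' Ioo (L 0) (R α)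
  let V : Set UnitAddCircle := (fun x : ℝ => (x : UnitAddCircle)) '' Ioo (L α) (R 1)
  have hU : IsOpen U := hopen _ isOpen_Ioo
  have hV : IsOpen V := hopen _ isOpen_Ioo
  have hUV : ∀ z ∈ K, z ∈ U ∨ z ∈ V := by
    rintro _ ⟨x, hx, rfl⟩
    obtain ⟨m, hm, -⟩ := existsUnique_add_zsmul_mem_Ico (zero_lt_one' ℝ) x (R 0)
    simp only [zsmul_eq_mul, mul_one] at hm
    have hx' := B.Kt_add_int hx m
    rw [show ((fun x : ℝ => (x : UnitAddCircle)) x) = ((x + m : ℝ) : UnitAddCircle) from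
      (coe_add_int x m).symm]
    rcases nogap _ hx' α with h2 | h2
    · exact Or.inl ⟨_, ⟨by linarith [hm.1], by linarith⟩, rfl⟩
    · exact Or.inr ⟨_, ⟨by linarith, by linarith [hm.2]⟩, rfl⟩
  have hdisj : ∀ z ∈ K, z ∈ U → z ∉ V := by
    rintro z hz ⟨x, hx, rfl⟩ ⟨y, hy, hxy⟩
    have hx' : x ∈ B.Kt := (hKmem x).1 hz
    have hy' : y ∈ B.Kt := by
      rw [← hKmem]; simp only at hxy; rw [hxy]; exact hz
    have a1 : R 0 ≤ x := (nogap x hx' 0).resolve_left (not_le.2 hx.1)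
    have a2 : x ≤ L α := (nogap x hx' α).resolve_right (not_le.2 hx.2)
    have b1 : R α ≤ y := (nogap y hy' α).resolve_left (not_le.2 hy.1)
    have b2 : y ≤ L 1 := (nogap y hy' 1).resolve_right (not_le.2 hy.2)
    have : y = x := (AddCircle.coe_eq_coe_iff_of_mem_Ico (p := (1 : ℝ)) (a := R 0)
      ⟨by linarith, by linarith⟩ ⟨by linarith, by linarith⟩).1 hxy
    linarith
  classical
  let c : K → ℤ → Bool := fun z n =>
    decide ((h.toEquiv ^ n : Equiv.Perm UnitAddCircle) (z : UnitAddCircle) ∈ U)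
  have hhn : ∀ n : ℤ, Continuous fun z => (h.toEquiv ^ n : Equiv.Perm UnitAddCircle) z := by
    intro n
    induction n using Int.induction_on with
    | zero => exact continuous_id
    | succ n ih => rw [zpow_add_one]; exact ih.comp h.continuous
    | pred n ih => rw [zpow_sub_one]; exact ih.comp h.symm.continuous
  have hcc : Continuous c := by
    apply continuous_pi
    intro n
    have hq : Continuous fun z : K => (h.toEquiv ^ n : Equiv.Perm UnitAddCircle) (z : UnitAddCircle) :=
      (hhn n).comp continuous_subtype_val
    have hcl : IsClopen ((fun z : K => (h.toEquiv ^ n : Equiv.Perm UnitAddCircle)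
        (z : UnitAddCircle)) ⁻¹' U) := by
      refine ⟨?_, hU.preimage hq⟩
      rw [← isOpen_compl_iff]
      convert hV.preimage hq using 1
      ext z
      have hz := hKpow n z z.2
      constructor
      · intro h2
        exact (hUV _ hz).resolve_left h2
      · intro h2 h3
        exact hdisj _ hz h3 h2
    rw [continuous_discrete_rng]
    intro b
    cases b
    · convert hcl.compl.isOpen using 1
      ext z
      simp [c]
    · convert hcl.isOpen using 1
      ext z
      simp [c]
  have hci : Function.Injective c := by
    have key : ∀ x ∈ B.Kt, ∀ y ∈ B.Kt, (x : UnitAddCircle) ≠ (y : UnitAddCircle) →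
        B.phi x ≤ B.phi y → B.phi y < B.phi x + 1 →
        ∃ n : ℤ, ¬ ((h.toEquiv ^ n : Equiv.Perm UnitAddCircle) (x : UnitAddCircle) ∈ U ↔
          (h.toEquiv ^ n : Equiv.Perm UnitAddCircle) (y : UnitAddCircle) ∈ U) := by
      have sep : ∀ x ∈ B.Kt, ∀ y ∈ B.Kt, ∀ n m : ℤ,
          (B.e.toEquiv ^ n : Equiv.Perm ℝ) x + m ∈ Ioo (L 0) (R α) →
          (B.e.toEquiv ^ n : Equiv.Perm ℝ) y + m ∈ Ioo (L α) (R 1) →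
          (h.toEquiv ^ n : Equiv.Perm UnitAddCircle) (x : UnitAddCircle) ∈ U ∧
          (h.toEquiv ^ n : Equiv.Perm UnitAddCircle) (y : UnitAddCircle) ∉ U := by
        intro x hx y hy n m h2 h3
        constructor
        · rw [hpow, ← coe_add_int _ m]
          exact ⟨_, h2, rfl⟩
        · intro h4
          apply hdisj _ (hKpow n y ((hKmem y).2 hy)) h4
          rw [hpow, ← coe_add_int _ m]
          exact ⟨_, h3, rfl⟩
      -- same fibre
      have same : ∀ x ∈ B.Kt, ∀ y ∈ B.Kt, x < y → B.phi x = B.phi y →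
        ∃ n : ℤ, ¬ ((h.toEquiv ^ n : Equiv.Perm UnitAddCircle) (x : UnitAddCircle) ∈ U ↔
          (h.toEquiv ^ n : Equiv.Perm UnitAddCircle) (y : UnitAddCircle) ∈ U) := by
        intro x hx y hy hxy hphi
        have q1 := B.L_phi_le x
        have q2 := B.le_R_phi y
        rw [← hphi] at q2
        obtain ⟨k, m, hkm⟩ := (B.gap (B.phi x)).1 (by linarith)
        refine ⟨-k, ?_⟩
        set x' := (B.e.toEquiv ^ (-k) : Equiv.Perm ℝ) x with hx'
        set y' := (B.e.toEquiv ^ (-k) : Equiv.Perm ℝ) y with hy'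
        have hxy' : x' < y' := B.zpow_strictMono (-k) hxy
        have px : B.phi x' = m := by
          rw [hx', B.phi_zpow, hkm]; push_cast; ring
        have py : B.phi y' = m := by
          rw [hy', B.phi_zpow, ← hphi, hkm]; push_cast; ring
        have ex := B.L_phi_le x'
        have ey := B.le_R_phi y'
        have kx : x' ∈ B.Kt := (B.zpow_mem _ _).2 hx
        have ky : y' ∈ B.Kt := (B.zpow_mem _ _).2 hy
        have eLm : L m = L 0 + m := by simpa using B.L_add_int 0 m
        have eRm : R m = R 0 + m := by simpa using B.R_add_int 0 m
        rw [px] at ex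
        rw [py] at ey
        have ex' : x' = L m := by
          rcases nogap x' kx m with h2 | h2 <;> linarith
        have ey' : y' = R m := by
          rcases nogap y' ky m with h2 | h2 <;> linarith
        have hyU : (h.toEquiv ^ (-k) : Equiv.Perm UnitAddCircle) (y : UnitAddCircle) ∈ U := by
          rw [hpow, ← hy', ey', eRm, coe_add_int]
          exact ⟨_, ⟨g0, by linarith⟩, rfl⟩
        have hxU : (h.toEquiv ^ (-k) : Equiv.Perm UnitAddCircle) (x : UnitAddCircle) ∉ U := by
          intro h4
          apply hdisj _ (hKpow (-k) x ((hKmem x).2 hx)) h4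
          rw [hpow, ← hx', ex', eLm, coe_add_int, ← coe_add_int _ 1]
          exact ⟨_, ⟨by push_cast; linarith, by push_cast; linarith⟩, rfl⟩
        tauto
      intro x hx y hy hne h2 h3
      rcases h2.lt_or_eq with h2 | h2
      · obtain ⟨n, m, h4, h5⟩ := Blowup.dense_aux hα
          (show max 0 (α - (B.phi y - B.phi x)) < min α (1 - (B.phi y - B.phi x)) by
            apply max_lt <;> apply lt_min <;> linarith) (B.phi x)
        rw [max_lt_iff] at h4
        rw [lt_min_iff] at h5
        refine ⟨n, ?_⟩
        have px : B.phi ((B.e.toEquiv ^ n : Equiv.Perm ℝ) x + m) = B.phi x + n * α + m := by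
          rw [B.phi_add_int, B.phi_zpow]
        have py : B.phi ((B.e.toEquiv ^ n : Equiv.Perm ℝ) y + m) = B.phi y + n * α + m := by
          rw [B.phi_add_int, B.phi_zpow]
        have between : ∀ z a b, a < B.phi z → B.phi z < b → L a < z ∧ z < R b := by
          intro z a b ha hb
          have := B.lt _ _ ha
          have := B.lt _ _ hb
          have := B.L_phi_le z
          have := B.le_R_phi z
          have := B.le a
          have := B.le b
          constructor <;> linarith
        have := sep x hx y hy n m
          (between _ _ _ (by rw [px]; linarith) (by rw [px]; linarith))
          (between _ _ _ (by rw [py]; linarith) (by rw [py]; linarith))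
        tauto
      · rcases lt_trichotomy x y with h4 | h4 | h4
        · exact same x hx y hy h4 h2
        · exact absurd (by rw [h4]) hne
        · obtain ⟨n, hn⟩ := same y hy x hx h4 h2.symm
          exact ⟨n, fun h5 => hn h5.symm⟩
    rintro ⟨_, x, hx, rfl⟩ ⟨_, y, hy, rfl⟩ hxy
    by_contra hne
    have hne' : (x : UnitAddCircle) ≠ (y : UnitAddCircle) := fun h2 => hne (Subtype.ext h2)
    obtain ⟨m, hm, -⟩ := existsUnique_add_zsmul_mem_Ico (zero_lt_one' ℝ) (B.phi y) (B.phi x)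
    simp only [zsmul_eq_mul, mul_one] at hm
    rw [← B.phi_add_int] at hm
    obtain ⟨n, hn⟩ := key x hx (y + m) (B.Kt_add_int hy m) (by rwa [coe_add_int]) hm.1 hm.2
    apply hn
    rw [coe_add_int]
    have := congrFun hxy n
    simpa [c] using this
  have hnear : ∀ x y : ℝ, y ∈ B.Kt → ∀ W ∈ 𝓝 (y : UnitAddCircle), ∃ n : ℤ,
      (h.toEquiv ^ n : Equiv.Perm UnitAddCircle) (x : UnitAddCircle) ∈ W ∧
      (h.toEquiv ^ n : Equiv.Perm UnitAddCircle) (x : UnitAddCircle) ≠ y := by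
    intro x y hy W hW
    have hW' := hcoe.continuousAt.preimage_mem_nhds hW
    obtain ⟨ε, hε, hball⟩ := Metric.mem_nhds_iff.1 hW'
    obtain ⟨n, m, h2, h3, h4⟩ := B.approx hα hy x hε
    refine ⟨n, ?_, ?_⟩
    · rw [hpow, ← coe_add_int _ m]
      exact hball (by rwa [Metric.mem_ball, Real.dist_eq])
    · rw [hpow, ← coe_add_int _ m]
      intro h5
      obtain ⟨k, hk⟩ := coe_eq_coe_iff_int.1 h5
      have h6 : B.phi y = B.phi ((B.e.toEquiv ^ n : Equiv.Perm ℝ) x + m) + k := by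
        rw [← B.phi_add_int, ← hk]
      rw [h6] at h3 h4
      rw [show ∀ a b : ℝ, a - (a + b) = -b by intros; ring, abs_neg] at h4
      have h7 : |k| < 1 := by exact_mod_cast h4
      rw [Int.abs_lt_one_iff] at h7
      apply h3
      simp [h7]
  have hKc : IsCompact K := hKclosed.isCompact
  have : CompactSpace K := isCompact_iff_compactSpace.1 hKc
  have htd : IsTotallyDisconnected K := by
    have e1 := (hcc.isClosedEmbedding hci).isEmbedding
    have e2 : TotallyDisconnectedSpace K := ⟨e1.isTotallyDisconnected
      (isTotallyDisconnected_of_totallyDisconnectedSpace _)⟩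
    exact totallyDisconnectedSpace_subtype_iff.1 e2
  let D : DenjoySystem :=
    { h := h
      K := K
      lift := B.G
      lift_mono := B.G_strictMono
      lift_cont := B.e.continuous
      lift_bij := B.e.bijective
      lift_add := B.G_add_one
      lift_proj := fun x => (hh x).symm
      rot := α
      rot_lim := B.tendsto_rot
      rot_irr := hα
      K_ne := ⟨_, L 0, B.L_mem 0, rfl⟩
      K_cpt := hKc
      K_proper := by
        intro hK
        have : (((L 0 + R 0) / 2 : ℝ) : UnitAddCircle) ∈ K := by rw [hK]; trivial
        rw [hKmem] at this
        exact B.not_mem_Kt.2 ⟨0, by linarith, by linarith⟩ this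
      K_inv := by
        apply Subset.antisymm
        · rintro _ ⟨z, hz, rfl⟩
          simpa using hKpow 1 z hz
        · intro z hz
          refine ⟨h.symm z, ?_, h.apply_symm_apply z⟩
          have := hKpow (-1) z hz
          rw [zpow_neg_one] at this
          exact this
      K_perf := by
        refine ⟨hKclosed, ?_⟩
        rintro _ ⟨y, hy, rfl⟩
        rw [accPt_iff_nhds]
        intro W hW
        obtain ⟨n, h2, h3⟩ := hnear y y hy W hW
        exact ⟨_, ⟨h2, hKpow n _ ⟨y, hy, rfl⟩⟩, h3⟩
      K_td := htd
      K_min := by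
        rintro _ ⟨x, hx, rfl⟩ _ ⟨y, hy, rfl⟩
        rw [mem_closure_iff_nhds]
        intro W hW
        obtain ⟨n, h2, -⟩ := hnear x y hy W hW
        exact ⟨_, h2, n, rfl⟩ }
  refine ⟨D, c, rfl, hcc, hci, ?_⟩
  intro x y hxy n
  have : (h.toEquiv ^ (n + 1) : Equiv.Perm UnitAddCircle) (x : UnitAddCircle) =
      (h.toEquiv ^ n : Equiv.Perm UnitAddCircle) (y : UnitAddCircle) := by
    rw [zpow_add_one, Equiv.Perm.mul_apply, ← hxy]
    rfl
  simp only [c, this]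

/-- A horseshoe (an invariant set conjugate to a non-trivial transitive subshift of
finite type) of a homeomorphism `f` contains, for some power `f^N` and every irrational
`α ∈ (0, 1/2)`, a weak Denjoy sub-system for `f^N` with rotation number `α`. -/
theorem horseshoe_contains_WDS
    {M : Type*} [MetricSpace M] (f : M → M) (hf : IsHomeomorph f)
    (H : Set M) (p : ℕ) (hp : 1 ≤ p) (A : Fin p → Fin p → Bool)
    (hA : MatIrreducible A) (hinf : (SubshiftSFT A).Infinite)
    (k : (SubshiftSFT A) → M) (hk : Topology.IsEmbedding k)
    (hrange : Set.range k = H)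
    (hconj : ∀ u v : SubshiftSFT A,
      (∀ m : ℤ, (v : ℤ → Fin p) m = (u : ℤ → Fin p) (m + 1)) → f (k u) = k v) :
    ∃ N : ℕ, 1 ≤ N ∧ ∀ α : ℝ, Irrational α → 0 < α → α < 1 / 2 →
      ∃ W : WDS M (f^[N]), (W.rot : UnitAddCircle) = (α : UnitAddCircle) ∧
        Set.range W.j ⊆ H := by
  obtain ⟨N, E, hN, hEc, hEi, hEs⟩ := exists_full_shift A hA hinf
  refine ⟨N, hN, fun α hα h0 h1 => ?_⟩
  obtain ⟨D, c, hrot, hcc, hci, hcs⟩ := exists_denjoy α hα h0 (by linarith)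
  have hiter : ∀ (n : ℕ) (u v : SubshiftSFT A),
      (∀ m : ℤ, (v : ℤ → Fin p) m = (u : ℤ → Fin p) (m + n)) → f^[n] (k u) = k v := by
    intro n
    induction n with
    | zero =>
      intro u v huv
      have : u = v := Subtype.ext (funext fun m => by simpa using (huv m).symm)
      rw [this]; rfl
    | succ n ih =>
      intro u v huv
      let u' : SubshiftSFT A := ⟨fun m => (u : ℤ → Fin p) (m + 1), fun m => u.2 (m + 1)⟩
      rw [Function.iterate_succ_apply, hconj u u' fun m => rfl]
      apply ih
      intro m
      rw [huv]
      show (u : ℤ → Fin p) _ = (u : ℤ → Fin p) _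
      exact congrArg _ (by push_cast; ring)
  have : CompactSpace D.K := isCompact_iff_compactSpace.1 D.K_cpt
  have hj : Topology.IsEmbedding (fun x : D.K => k (E (c x))) :=
    ((hk.continuous.comp (hEc.comp hcc)).isClosedEmbedding
      (hk.injective.comp (hEi.comp hci))).isEmbedding
  have heq : ∀ x y : D.K, D.h (x : UnitAddCircle) = (y : UnitAddCircle) →
      k (E (c y)) = f^[N] (k (E (c x))) := by
    intro x y hxy
    exact (hiter N _ _ (hEs _ _ (hcs x y hxy))).symm
  refine ⟨{ toDenjoySystem := D, j := fun x => k (E (c x)), j_emb := hj, range_inv := ?_,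
            equivar := heq }, by rw [hrot], ?_⟩
  · apply Subset.antisymm
    · rintro _ ⟨_, ⟨x, rfl⟩, rfl⟩
      have hx : D.h (x : UnitAddCircle) ∈ D.K := by
        exact D.K_inv.subset ⟨x, x.2, rfl⟩
      exact ⟨⟨_, hx⟩, heq x ⟨_, hx⟩ rfl⟩
    · rintro _ ⟨y, rfl⟩
      have hy : (y : UnitAddCircle) ∈ D.h '' D.K := D.K_inv.superset y.2
      obtain ⟨x, hx, hxy⟩ := hy
      exact ⟨_, ⟨⟨x, hx⟩, rfl⟩, (heq ⟨x, hx⟩ y hxy).symm⟩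
  · rintro _ ⟨x, rfl⟩
    rw [← hrange]
    exact ⟨_, rfl⟩
end
end
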